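/- dim H^3_k(m_2) = 1 if k = 3m with m ≥ 4 (i.e., k ∈ {12, 15, 18, ...}), and 0 otherwise; a basis is given by the cocycles w_{j,j+1,j+2} = Σ_{l≥0} ω(e^{j-2l} ∧ e^{j+1+l} ∧ e^{j+2+l}) for j ≥ 3. -/

import Mathlib

variable (K : Type*) [Field K] [CharZero K]

/-- The cochain `e^i` (for `i ≥ 1`) dual to the basis vector `e_i` of the Lie algebra
`m₂` (basis `e_1, e_2, ...`, brackets `[e_1, e_i] = e_{i+1}` for `i ≥ 2` and
`[e_2, e_j] = e_{j+2}` for `j ≥ 3`); the cochain complex of `m₂` is the exterior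
algebra on the span of the `e^i`, `i ≥ 1`. -/
noncomputable def e (i : ℕ) : ExteriorAlgebra K (ℕ →₀ K) :=
  ExteriorAlgebra.ι K (Finsupp.single (i - 1) (1 : K))

/-- The monomial cochain `e^{i_1} ∧ ... ∧ e^{i_q}`. -/
noncomputable def mono (s : Finset ℕ) : ExteriorAlgebra K (ℕ →₀ K) :=
  ((s.sort (· ≤ ·)).map (e K)).prod

/-- `C^q_k`: the span of the `q`-cochains `e^{i_1} ∧ ... ∧ e^{i_q}`,
`1 ≤ i_1 < ... < i_q`, of weight `i_1 + ... + i_q = k`. -/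
noncomputable def LamWt (q k : ℕ) : Submodule K (ExteriorAlgebra K (ℕ →₀ K)) :=
  Submodule.span K {x | ∃ s : Finset ℕ,
    s.card = q ∧ (∀ i ∈ s, 1 ≤ i) ∧ (∑ i ∈ s, i) = k ∧ x = mono K s}

/-- `C^q`: the span of the `q`-cochains `e^{i_1} ∧ ... ∧ e^{i_q}` (all weights). -/
noncomputable def LamDeg (q : ℕ) : Submodule K (ExteriorAlgebra K (ℕ →₀ K)) :=
  Submodule.span K {x | ∃ s : Finset ℕ,
    s.card = q ∧ (∀ i ∈ s, 1 ≤ i) ∧ x = mono K s}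

section Auxiliary

set_option linter.unusedSectionVars false

variable {K}

section Coefficients

open ExteriorAlgebra CliffordAlgebra

/-- The linear coordinate dual to `e^x`. -/
noncomputable def coord (x : ℕ) : Module.Dual K (ℕ →₀ K) := Finsupp.lapply (x - 1)

/-- The vector whose image in the exterior algebra is `e^a`. -/
noncomputable def vec (a : ℕ) : ℕ →₀ K := Finsupp.single (a - 1) 1

/-- The vector `e^{a-s}`, truncated to zero unless `a ≥ r`. -/
noncomputable def shiftVec (r s a : ℕ) : ℕ →₀ K := if r ≤ a then vec (a - s) else 0

lemma e_eq_ι_vec (a : ℕ) : e K a = ι K (vec a) := rfl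

lemma coord_vec {x a : ℕ} (hx : 1 ≤ x) (ha : 1 ≤ a) :
    coord (K := K) x (vec a) = if x = a then 1 else 0 := by
  have : (a - 1 = x - 1) ↔ x = a := by omega
  simp [coord, vec, Finsupp.single_apply, this]

lemma coord_shiftVec_one {x a : ℕ} (hx : 2 ≤ x) (ha : 2 ≤ a) :
    coord (K := K) x (shiftVec 3 1 a) = coord (x + 1) (vec a) := by
  rw [coord_vec (by omega) (by omega), shiftVec]
  split_ifs <;> first | omega | (rw [coord_vec (by omega) (by omega)]; simp; omega) | simp

lemma coord_shiftVec_two {x a : ℕ} (hx : 3 ≤ x) (ha : 2 ≤ a) :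
    coord (K := K) x (shiftVec 5 2 a) = coord (x + 2) (vec a) := by
  rw [coord_vec (by omega) (by omega), shiftVec]
  split_ifs <;> first | omega | (rw [coord_vec (by omega) (by omega)]; simp; omega) | simp

/-- The coefficient of a cochain at `e^y ∧ e^z`, antisymmetric in `y, z`. -/
noncomputable def coef₂ (y z : ℕ) : ExteriorAlgebra K (ℕ →₀ K) →ₗ[K] K :=
  (algebraMapInv (R := K) (M := ℕ →₀ K)).toLinearMap ∘ₗ
    contractLeft (Q := (0 : QuadraticForm K (ℕ →₀ K))) (coord z) ∘ₗ
    contractLeft (Q := (0 : QuadraticForm K (ℕ →₀ K))) (coord y)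

/-- The coefficient of a cochain at `e^x ∧ e^y ∧ e^z`, antisymmetric in `x, y, z`. -/
noncomputable def coef₃ (x y z : ℕ) : ExteriorAlgebra K (ℕ →₀ K) →ₗ[K] K :=
  coef₂ y z ∘ₗ contractLeft (Q := (0 : QuadraticForm K (ℕ →₀ K))) (coord x)

/-- Interior multiplication by the basis vector `e_x`. -/
noncomputable def contr (x : ℕ) :
    ExteriorAlgebra K (ℕ →₀ K) →ₗ[K] ExteriorAlgebra K (ℕ →₀ K) :=
  contractLeft (Q := (0 : QuadraticForm K (ℕ →₀ K))) (coord x)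

lemma contr_mul (x : ℕ) (v : ℕ →₀ K) (b : ExteriorAlgebra K (ℕ →₀ K)) :
    contr x (ι K v * b) = coord x v • b - ι K v * contr x b :=
  contractLeft_ι_mul _ _ _

lemma coef₂_apply (y z : ℕ) (u : ExteriorAlgebra K (ℕ →₀ K)) :
    coef₂ y z u = algebraMapInv (contr z (contr y u)) := rfl

lemma coef₃_apply (x y z : ℕ) (u : ExteriorAlgebra K (ℕ →₀ K)) :
    coef₃ x y z u = coef₂ y z (contr x u) := rfl

lemma coef₂_ι_mul_ι (y z : ℕ) (v w : ℕ →₀ K) :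
    coef₂ y z (ι K v * ι K w) = coord y v * coord z w - coord z v * coord y w := by
  have h (x : ℕ) (v : ℕ →₀ K) : contr x (ι K v) = algebraMap K _ (coord x v) :=
    contractLeft_ι _ _ _
  have h' (x : ℕ) (r : K) : contr x (algebraMap K (ExteriorAlgebra K (ℕ →₀ K)) r) = 0 :=
    contractLeft_algebraMap _ _ _
  have h0 (v : ℕ →₀ K) : algebraMapInv (ι K v) = 0 := by simp [algebraMapInv]
  have h1 (r : K) : algebraMapInv (algebraMap K (ExteriorAlgebra K (ℕ →₀ K)) r) = r :=
    algebraMap_leftInverse _ _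
  rw [coef₂_apply, contr_mul, map_sub, map_smul, h, h, contr_mul, h']
  simp [h1]

lemma coef₃_ι_mul (x y z : ℕ) (v : ℕ →₀ K) (b : ExteriorAlgebra K (ℕ →₀ K)) :
    coef₃ x y z (ι K v * b) =
      coord x v * coef₂ y z b - coord y v * coef₂ x z b + coord z v * coef₂ x y b := by
  have h0 (v : ℕ →₀ K) : algebraMapInv (ι K v) = 0 := by simp [algebraMapInv]
  simp only [coef₃_apply, coef₂_apply, contr_mul, map_sub, map_smul, map_mul, h0, smul_eq_mul,
    zero_mul]
  ring

lemma contr_comm (x y : ℕ) (u : ExteriorAlgebra K (ℕ →₀ K)) :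
    contr x (contr y u) = -contr y (contr x u) :=
  contractLeft_comm _ _ _

lemma contr_contr (x : ℕ) (u : ExteriorAlgebra K (ℕ →₀ K)) : contr x (contr x u) = 0 :=
  contractLeft_contractLeft _ _

lemma coef₂_self (x : ℕ) (u : ExteriorAlgebra K (ℕ →₀ K)) : coef₂ x x u = 0 := by
  rw [coef₂_apply, contr_contr, map_zero]

lemma coef₂_swap (x y : ℕ) (u : ExteriorAlgebra K (ℕ →₀ K)) :
    coef₂ y x u = -coef₂ x y u := by
  rw [coef₂_apply, coef₂_apply, contr_comm x y, map_neg]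

lemma coef₃_swap_right (x y z : ℕ) (u : ExteriorAlgebra K (ℕ →₀ K)) :
    coef₃ x z y u = -coef₃ x y z u := by
  rw [coef₃_apply, coef₃_apply, coef₂_swap y z]

lemma coef₃_swap_left (x y z : ℕ) (u : ExteriorAlgebra K (ℕ →₀ K)) :
    coef₃ y x z u = -coef₃ x y z u := by
  rw [coef₃_apply, coef₃_apply, coef₂_apply, coef₂_apply, contr_comm x y, map_neg, map_neg]

lemma coef₃_self_right (x y : ℕ) (u : ExteriorAlgebra K (ℕ →₀ K)) : coef₃ x y y u = 0 := by
  rw [coef₃_apply, coef₂_self]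

lemma coef₃_self_left (x y : ℕ) (u : ExteriorAlgebra K (ℕ →₀ K)) : coef₃ x x y u = 0 := by
  rw [coef₃_apply, coef₂_apply, contr_contr, map_zero, map_zero]

end Coefficients

section Spans

open ExteriorAlgebra

lemma e_mul_self (a : ℕ) : e K a * e K a = 0 := ι_sq_zero _

lemma ι_mul_ι_comm (v w : ℕ →₀ K) : ι K v * ι K w = -(ι K w * ι K v) :=
  eq_neg_of_add_eq_zero_left (ι_add_mul_swap v w)

lemma ι_mul_ι_mul_comm (v w : ℕ →₀ K) (b : ExteriorAlgebra K (ℕ →₀ K)) :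
    ι K v * (ι K w * b) = -(ι K w * (ι K v * b)) := by
  rw [← mul_assoc, ι_mul_ι_comm, neg_mul, mul_assoc]

lemma e_mul_self_mul (a : ℕ) (b : ExteriorAlgebra K (ℕ →₀ K)) : e K a * (e K a * b) = 0 := by
  rw [← mul_assoc, e_mul_self, zero_mul]

variable (K) in
/-- The span of the `e^a ∧ e^b` with `a, b ≥ r` and weight `k - s`. -/
noncomputable def span₂ (r s k : ℕ) : Submodule K (ExteriorAlgebra K (ℕ →₀ K)) :=
  Submodule.span K {x | ∃ a b, r ≤ a ∧ r ≤ b ∧ a + b + s = k ∧ x = e K a * e K b}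

variable (K) in
/-- The span of the `e^a ∧ e^b ∧ e^c` with `a, b, c ≥ r` and weight `k - s`. -/
noncomputable def span₃ (r s k : ℕ) : Submodule K (ExteriorAlgebra K (ℕ →₀ K)) :=
  Submodule.span K {x | ∃ a b c, r ≤ a ∧ r ≤ b ∧ r ≤ c ∧ a + b + c + s = k ∧
    x = e K a * (e K b * e K c)}

lemma mul_mem_span₂ {r s k a b : ℕ} (ha : r ≤ a) (hb : r ≤ b) (h : a + b + s = k) :
    e K a * e K b ∈ span₂ K r s k :=
  Submodule.subset_span ⟨a, b, ha, hb, h, rfl⟩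

lemma mul_mem_span₃ {r s k a b c : ℕ} (ha : r ≤ a) (hb : r ≤ b) (hc : r ≤ c)
    (h : a + b + c + s = k) : e K a * (e K b * e K c) ∈ span₃ K r s k :=
  Submodule.subset_span ⟨a, b, c, ha, hb, hc, h, rfl⟩

lemma e_mul_mem_span₃ {r s t k a : ℕ} (ha : r ≤ a) (hs : s = t + a)
    {v : ExteriorAlgebra K (ℕ →₀ K)} (hv : v ∈ span₂ K r s k) : e K a * v ∈ span₃ K r t k := by
  induction hv using Submodule.span_induction with
  | mem x hx =>
    obtain ⟨b, c, hb, hc, h, rfl⟩ := hx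
    exact mul_mem_span₃ ha hb hc (by omega)
  | zero => simp
  | add x y _ _ hx hy => rw [mul_add]; exact add_mem hx hy
  | smul t x _ hx => rw [mul_smul_comm]; exact Submodule.smul_mem _ _ hx

lemma mul_e_mem_span₃ {r s t k a : ℕ} (ha : r ≤ a) (hs : s = t + a)
    {v : ExteriorAlgebra K (ℕ →₀ K)} (hv : v ∈ span₂ K r s k) : v * e K a ∈ span₃ K r t k := by
  induction hv using Submodule.span_induction with
  | mem x hx =>
    obtain ⟨b, c, hb, hc, h, rfl⟩ := hx
    rw [mul_assoc]
    exact mul_mem_span₃ hb hc ha (by omega)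
  | zero => simp
  | add x y _ _ hx hy => rw [add_mul]; exact add_mem hx hy
  | smul t x _ hx => rw [smul_mul_assoc]; exact Submodule.smul_mem _ _ hx

lemma span₂_mono {r r' s k : ℕ} (h : r ≤ r') : span₂ K r' s k ≤ span₂ K r s k := by
  apply Submodule.span_mono
  rintro x ⟨a, b, ha, hb, hk, rfl⟩
  exact ⟨a, b, h.trans ha, h.trans hb, hk, rfl⟩

lemma span₃_mono {r r' s k : ℕ} (h : r ≤ r') : span₃ K r' s k ≤ span₃ K r s k := by
  apply Submodule.span_mono
  rintro x ⟨a, b, c, ha, hb, hc, hk, rfl⟩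
  exact ⟨a, b, c, h.trans ha, h.trans hb, h.trans hc, hk, rfl⟩

lemma mono_pair {a b : ℕ} (h : a < b) : mono K {a, b} = e K a * e K b := by
  have : ({a, b} : Finset ℕ).sort (· ≤ ·) = [a, b] := by
    rw [Finset.sort_insert, Finset.sort_singleton]
    · simpa using h.le
    · simpa using h.ne
  simp [mono, this]

lemma mono_triple {a b c : ℕ} (h : a < b) (h' : b < c) :
    mono K {a, b, c} = e K a * (e K b * e K c) := by
  have : ({a, b, c} : Finset ℕ).sort (· ≤ ·) = [a, b, c] := by
    rw [Finset.sort_insert, Finset.sort_insert, Finset.sort_singleton]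
    · simpa using h'.le
    · simpa using h'.ne
    · simpa using ⟨h.le, (h.trans h').le⟩
    · simpa using ⟨h.ne, (h.trans h').ne⟩
  simp [mono, this]

lemma exists_sorted_of_card_eq_two {s : Finset ℕ} (hs : s.card = 2) :
    ∃ a b, a < b ∧ s = {a, b} := by
  obtain ⟨a, b, hab, rfl⟩ := Finset.card_eq_two.mp hs
  rcases lt_or_gt_of_ne hab with h | h
  · exact ⟨a, b, h, rfl⟩
  · exact ⟨b, a, h, Finset.pair_comm _ _⟩

lemma exists_sorted_of_card_eq_three {s : Finset ℕ} (hs : s.card = 3) :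
    ∃ a b c, a < b ∧ b < c ∧ s = {a, b, c} := by
  refine ⟨s.orderEmbOfFin hs 0, s.orderEmbOfFin hs 1, s.orderEmbOfFin hs 2, ?_, ?_, ?_⟩
  · simp
  · simp
  · have := Finset.range_orderEmbOfFin s hs
    rw [← Finset.coe_inj, ← this]
    ext x
    simp only [Set.mem_range, Finset.coe_insert, Finset.coe_singleton, Set.mem_insert_iff,
      Set.mem_singleton_iff, Fin.exists_fin_succ, Fin.exists_fin_zero, or_false, eq_comm]
    rfl

lemma LamWt_two (k : ℕ) : LamWt K 2 k = span₂ K 1 0 k := by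
  apply le_antisymm
  · apply Submodule.span_le.mpr
    rintro x ⟨s, hs, h1, hk, rfl⟩
    obtain ⟨a, b, hab, rfl⟩ := exists_sorted_of_card_eq_two hs
    rw [Finset.sum_pair hab.ne] at hk
    rw [mono_pair hab]
    exact mul_mem_span₂ (h1 _ (by simp)) (h1 _ (by simp)) hk
  · apply Submodule.span_le.mpr
    have key (a b : ℕ) (ha : 1 ≤ a) (hab : a < b) (hk : a + b = k) :
        e K a * e K b ∈ LamWt K 2 k :=
      Submodule.subset_span ⟨{a, b}, Finset.card_pair hab.ne, by simp; omega,
        by rw [Finset.sum_pair hab.ne, hk], (mono_pair hab).symm⟩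
    rintro x ⟨a, b, ha, hb, hk, rfl⟩
    rcases lt_trichotomy a b with h | rfl | h
    · exact key a b ha h hk
    · rw [e_mul_self]; exact zero_mem _
    · rw [e_eq_ι_vec, e_eq_ι_vec, ι_mul_ι_comm]
      exact neg_mem (key b a hb h (by omega))

lemma LamWt_three (k : ℕ) : LamWt K 3 k = span₃ K 1 0 k := by
  apply le_antisymm
  · apply Submodule.span_le.mpr
    rintro x ⟨s, hs, h1, hk, rfl⟩
    obtain ⟨a, b, c, hab, hbc, rfl⟩ := exists_sorted_of_card_eq_three hs
    rw [Finset.sum_insert (by simp; omega), Finset.sum_pair hbc.ne] at hk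
    rw [mono_triple hab hbc]
    exact mul_mem_span₃ (h1 _ (by simp)) (h1 _ (by simp)) (h1 _ (by simp)) (by omega)
  · apply Submodule.span_le.mpr
    have key (a b c : ℕ) (ha : 1 ≤ a) (hab : a < b) (hbc : b < c) (hk : a + b + c = k) :
        e K a * (e K b * e K c) ∈ LamWt K 3 k :=
      Submodule.subset_span ⟨{a, b, c}, Finset.card_eq_three.mpr
        ⟨a, b, c, hab.ne, (hab.trans hbc).ne, hbc.ne, rfl⟩, by simp; omega,
        by rw [Finset.sum_insert (by simp; omega), Finset.sum_pair hbc.ne]; omega,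
        (mono_triple hab hbc).symm⟩
    have key' (a b c : ℕ) (ha : 1 ≤ a) (hb : 1 ≤ b) (hbc : b < c) (hk : a + b + c = k) :
        e K a * (e K b * e K c) ∈ LamWt K 3 k := by
      rcases lt_trichotomy a b with h | rfl | h
      · exact key a b c ha h hbc hk
      · rw [e_mul_self_mul]; exact zero_mem _
      · rw [e_eq_ι_vec, e_eq_ι_vec, ι_mul_ι_mul_comm]
        rcases lt_trichotomy a c with h' | rfl | h'
        · exact neg_mem (key b a c hb h h' (by omega))
        · rw [← e_eq_ι_vec, ← e_eq_ι_vec, e_mul_self, mul_zero, neg_zero]; exact zero_mem _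
        · rw [e_eq_ι_vec c, ι_mul_ι_comm (vec a), mul_neg, neg_neg]
          exact key b c a hb hbc h' (by omega)
    rintro x ⟨a, b, c, ha, hb, hc, hk, rfl⟩
    rcases lt_trichotomy b c with h | rfl | h
    · exact key' a b c ha hb h hk
    · rw [e_mul_self, mul_zero]; exact zero_mem _
    · rw [e_eq_ι_vec b, e_eq_ι_vec c, ι_mul_ι_comm, mul_neg]
      exact neg_mem (key' a c b ha hc h (by omega))

end Spans

section Coefficients

open ExteriorAlgebra

lemma coef₂_e_mul_e {x y a b : ℕ} (hx : 1 ≤ x) (hy : 1 ≤ y) (ha : 1 ≤ a) (hb : 1 ≤ b) :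
    coef₂ x y (e K a * e K b) =
      (if x = a then if y = b then 1 else 0 else 0) -
        (if y = a then if x = b then 1 else 0 else 0) := by
  rw [e_eq_ι_vec, e_eq_ι_vec, coef₂_ι_mul_ι, coord_vec hx ha, coord_vec hy ha, coord_vec hx hb,
    coord_vec hy hb, ite_zero_mul_ite_zero, ite_zero_mul_ite_zero, ite_and, ite_and, mul_one]

lemma coef₃_e_mul {x y z a : ℕ} (hx : 1 ≤ x) (hy : 1 ≤ y) (hz : 1 ≤ z) (ha : 1 ≤ a)
    (v : ExteriorAlgebra K (ℕ →₀ K)) :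
    coef₃ x y z (e K a * v) =
      (if x = a then coef₂ y z v else 0) - (if y = a then coef₂ x z v else 0) +
        (if z = a then coef₂ x y v else 0) := by
  rw [e_eq_ι_vec, coef₃_ι_mul, coord_vec hx ha, coord_vec hy ha, coord_vec hz ha]
  simp only [ite_mul, one_mul, zero_mul]

lemma coef₂_eq_zero {r s k x y : ℕ} (hr : 1 ≤ r) (hx : 1 ≤ x) (hy : 1 ≤ y)
    {v : ExteriorAlgebra K (ℕ →₀ K)} (hv : v ∈ span₂ K r s k)
    (h : x < r ∨ y < r ∨ x + y + s ≠ k) : coef₂ x y v = 0 := by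
  induction hv using Submodule.span_induction with
  | mem u hu =>
    obtain ⟨a, b, ha, hb, hk, rfl⟩ := hu
    rw [coef₂_e_mul_e hx hy (by omega) (by omega)]
    split_ifs <;> first | omega | simp
  | zero => simp
  | add u v _ _ hu hv => rw [map_add, hu, hv, add_zero]
  | smul t u _ hu => rw [map_smul, hu, smul_zero]

lemma coef₃_eq_zero {r s k x y z : ℕ} (hr : 1 ≤ r) (hx : 1 ≤ x) (hy : 1 ≤ y) (hz : 1 ≤ z)
    {v : ExteriorAlgebra K (ℕ →₀ K)} (hv : v ∈ span₃ K r s k)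
    (h : x < r ∨ y < r ∨ z < r ∨ x + y + z + s ≠ k) : coef₃ x y z v = 0 := by
  induction hv using Submodule.span_induction with
  | mem u hu =>
    obtain ⟨a, b, c, ha, hb, hc, hk, rfl⟩ := hu
    have hm : e K b * e K c ∈ span₂ K r (s + a) k := mul_mem_span₂ hb hc (by omega)
    have key {x' y' : ℕ} (hx' : 1 ≤ x') (hy' : 1 ≤ y')
        (h' : x' < r ∨ y' < r ∨ x' + y' + (s + a) ≠ k) : coef₂ x' y' (e K b * e K c) = 0 :=
      coef₂_eq_zero hr hx' hy' hm h'
    rw [coef₃_e_mul hx hy hz (by omega), ite_eq_right_iff.mpr fun _ => key hy hz (by omega),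
      ite_eq_right_iff.mpr fun _ => key hx hz (by omega),
      ite_eq_right_iff.mpr fun _ => key hx hy (by omega), sub_zero, add_zero]
  | zero => simp
  | add u v _ _ hu hv => rw [map_add, hu, hv, add_zero]
  | smul t u _ hu => rw [map_smul, hu, smul_zero]

lemma sum_coef₃ {r s k : ℕ} (hr : 1 ≤ r) {u : ExteriorAlgebra K (ℕ →₀ K)}
    (hu : u ∈ span₃ K r s k) :
    ∑ x ∈ Finset.Icc 1 k, ∑ y ∈ Finset.Icc 1 k, ∑ z ∈ Finset.Icc 1 k,
      coef₃ x y z u • (e K x * (e K y * e K z)) = (6 : K) • u := by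
  induction hu using Submodule.span_induction with
  | mem u hu =>
    obtain ⟨a, b, c, ha, hb, hc, hk, rfl⟩ := hu
    have ha' : a ∈ Finset.Icc 1 k := by simp; omega
    have hb' : b ∈ Finset.Icc 1 k := by simp; omega
    have hc' : c ∈ Finset.Icc 1 k := by simp; omega
    have hs (p q r : ℕ) (hp : p ∈ Finset.Icc 1 k) (hq : q ∈ Finset.Icc 1 k)
        (hr : r ∈ Finset.Icc 1 k) : (∑ x ∈ Finset.Icc 1 k, ∑ y ∈ Finset.Icc 1 k,
        ∑ z ∈ Finset.Icc 1 k, (coord (K := K) x (vec p) * coord y (vec q) * coord z (vec r)) •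
          (e K x * (e K y * e K z))) = e K p * (e K q * e K r) := by
      have h₁ {x p : ℕ} (hx : x ∈ Finset.Icc 1 k) (hp : p ∈ Finset.Icc 1 k) (h : x ≠ p) :
          coord (K := K) x (vec p) = 0 := by
        simp only [Finset.mem_Icc] at hx hp
        rw [coord_vec hx.1 hp.1, if_neg h]
      have h₂ {p : ℕ} (hp : p ∈ Finset.Icc 1 k) : coord (K := K) p (vec p) = 1 := by
        simp only [Finset.mem_Icc] at hp
        rw [coord_vec hp.1 hp.1, if_pos rfl]
      rw [Finset.sum_eq_single_of_mem p hp, Finset.sum_eq_single_of_mem q hq,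
        Finset.sum_eq_single_of_mem r hr, h₂ hp, h₂ hq, h₂ hr, mul_one, mul_one, one_smul]
      · intro z hz hne
        rw [h₁ hz hr hne, mul_zero, zero_smul]
      · intro y hy hne
        exact Finset.sum_eq_zero fun z _ => by rw [h₁ hy hq hne, mul_zero, zero_mul, zero_smul]
      · intro x hx hne
        exact Finset.sum_eq_zero fun y _ => Finset.sum_eq_zero fun z _ => by
          rw [h₁ hx hp hne, zero_mul, zero_mul, zero_smul]
    have key (x y z : ℕ) (m : ExteriorAlgebra K (ℕ →₀ K)) :
        coef₃ x y z (e K a * (e K b * e K c)) • m =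
        (coord (K := K) x (vec a) * coord y (vec b) * coord z (vec c)) • m -
        (coord (K := K) x (vec a) * coord y (vec c) * coord z (vec b)) • m -
        (coord (K := K) x (vec b) * coord y (vec a) * coord z (vec c)) • m +
        (coord (K := K) x (vec c) * coord y (vec a) * coord z (vec b)) • m +
        (coord (K := K) x (vec b) * coord y (vec c) * coord z (vec a)) • m -
        (coord (K := K) x (vec c) * coord y (vec b) * coord z (vec a)) • m := by
      rw [e_eq_ι_vec, e_eq_ι_vec b, e_eq_ι_vec c, coef₃_ι_mul, coef₂_ι_mul_ι, coef₂_ι_mul_ι,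
        coef₂_ι_mul_ι]
      module
    simp only [key, Finset.sum_add_distrib, Finset.sum_sub_distrib]
    rw [hs _ _ _ ha' hb' hc', hs _ _ _ ha' hc' hb', hs _ _ _ hb' ha' hc', hs _ _ _ hc' ha' hb',
      hs _ _ _ hb' hc' ha', hs _ _ _ hc' hb' ha']
    simp only [e_eq_ι_vec]
    rw [ι_mul_ι_comm (vec c) (vec b), ι_mul_ι_mul_comm (vec c) (vec a),
      ι_mul_ι_mul_comm (vec c) (vec b), ι_mul_ι_comm (vec c) (vec b), ι_mul_ι_comm (vec c) (vec a),
      mul_neg, mul_neg, ι_mul_ι_mul_comm (vec b) (vec a)]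
    module
  | zero => simp
  | add u v _ _ hu hv =>
    simp only [map_add, add_smul, Finset.sum_add_distrib, hu, hv, smul_add]
  | smul t u _ hu =>
    simp only [map_smul, smul_assoc, ← Finset.smul_sum, hu]
    rw [smul_comm]

lemma eq_zero_of_coef₃ {r s k : ℕ} (hr : 1 ≤ r) {u : ExteriorAlgebra K (ℕ →₀ K)}
    (hu : u ∈ span₃ K r s k)
    (h : ∀ x y z, 1 ≤ x → x < y → y < z → coef₃ x y z u = 0) : u = 0 := by
  have h' : ∀ x y z, 1 ≤ x → 1 ≤ y → y < z → coef₃ x y z u = 0 := by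
    intro x y z hx hy hyz
    rcases lt_trichotomy x y with hxy | rfl | hxy
    · exact h x y z hx hxy hyz
    · exact coef₃_self_left _ _ _
    · rw [coef₃_swap_left y x]
      rcases lt_trichotomy x z with hxz | rfl | hxz
      · rw [h y x z hy hxy hxz, neg_zero]
      · rw [coef₃_self_right, neg_zero]
      · rw [coef₃_swap_right y z x, h y z x hy hyz hxz, neg_zero, neg_zero]
  have h'' : ∀ x y z, 1 ≤ x → 1 ≤ y → 1 ≤ z → coef₃ x y z u = 0 := by
    intro x y z hx hy hz
    rcases lt_trichotomy y z with hyz | rfl | hyz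
    · exact h' x y z hx hy hyz
    · exact coef₃_self_right _ _ _
    · rw [coef₃_swap_right x z y, h' x z y hx hz hyz, neg_zero]
  have := sum_coef₃ hr hu
  rw [Finset.sum_eq_zero fun x hx => Finset.sum_eq_zero fun y hy => Finset.sum_eq_zero fun z hz =>
    by simp only [Finset.mem_Icc] at hx hy hz; rw [h'' x y z hx.1 hy.1 hz.1, zero_smul]] at this
  exact (smul_eq_zero.mp this.symm).resolve_left (by norm_num)

/-- If the coefficients of `u` with all indices `≥ 3` vanish, then `e^2 ∧ u = 0`. -/
lemma e_two_mul_eq_zero {s k : ℕ} {u : ExteriorAlgebra K (ℕ →₀ K)} (hu : u ∈ span₃ K 2 s k)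
    (h : ∀ x y z, 3 ≤ x → 3 ≤ y → 3 ≤ z → coef₃ x y z u = 0) : e K 2 * u = 0 := by
  have := congrArg (e K 2 * ·) (sum_coef₃ (by norm_num) hu)
  simp only [Finset.mul_sum, mul_smul_comm] at this
  rw [Finset.sum_eq_zero fun x hx => Finset.sum_eq_zero fun y hy => Finset.sum_eq_zero fun z hz =>
    ?_] at this
  · exact (smul_eq_zero.mp this.symm).resolve_left (by norm_num)
  · simp only [Finset.mem_Icc] at hx hy hz
    by_cases hlt : x < 2 ∨ y < 2 ∨ z < 2 ∨ x + y + z + s ≠ k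
    · rw [coef₃_eq_zero (by norm_num) hx.1 hy.1 hz.1 hu hlt, zero_smul]
    · push Not at hlt
      obtain rfl | hx3 : x = 2 ∨ 3 ≤ x := by omega
      · rw [e_mul_self_mul, smul_zero]
      obtain rfl | hy3 : y = 2 ∨ 3 ≤ y := by omega
      · rw [e_eq_ι_vec, e_eq_ι_vec x, ι_mul_ι_mul_comm, ← mul_assoc (ι K (vec 2)),
          ι_sq_zero, zero_mul, mul_zero, neg_zero, smul_zero]
      obtain rfl | hz3 : z = 2 ∨ 3 ≤ z := by omega
      · rw [e_eq_ι_vec, e_eq_ι_vec x, e_eq_ι_vec y, ι_mul_ι_mul_comm, ι_mul_ι_mul_comm (vec 2),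
          ι_sq_zero, mul_zero, neg_zero, mul_zero, neg_zero, smul_zero]
      · rw [h x y z hx3 hy3 hz3, zero_smul]

end Coefficients

section Derivations

open ExteriorAlgebra

/-- `d` is the Chevalley–Eilenberg differential of `m₂`. -/
structure IsCEDifferential (d : Module.End K (ExteriorAlgebra K (ℕ →₀ K))) : Prop where
  one : d (e K 1) = 0
  gen : ∀ a, 2 ≤ a →
    d (e K a) = e K 1 * ι K (shiftVec 3 1 a) + e K 2 * ι K (shiftVec 5 2 a)
  mul : ∀ a, 1 ≤ a → ∀ y, d (e K a * y) = d (e K a) * y - e K a * d y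

/-- `D` is the derivation with `D e^2 = 0` and `D e^a = e^{a-1}` for `a ≥ 3`. -/
structure IsShiftDerivation (D : Module.End K (ExteriorAlgebra K (ℕ →₀ K))) : Prop where
  gen : ∀ a, 2 ≤ a → D (e K a) = ι K (shiftVec 3 1 a)
  mul : ∀ x y, D (x * y) = D x * y + x * D y

lemma ι_shiftVec (r s a : ℕ) : ι K (shiftVec r s a) = if r ≤ a then e K (a - s) else 0 := by
  rw [shiftVec]; split_ifs <;> simp [e_eq_ι_vec]

variable {d D : Module.End K (ExteriorAlgebra K (ℕ →₀ K))}

lemma shift_mul_mem_span₂ {p t a b s s' k : ℕ} (hp : 2 + t ≤ p) (ha : 2 ≤ a) (hb : 2 ≤ b)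
    (hs : s' = s + t) (hk : a + b + s = k) :
    ι K (shiftVec p t a) * e K b + e K a * ι K (shiftVec p t b) ∈ span₂ K 2 s' k := by
  rw [ι_shiftVec, ι_shiftVec]
  apply add_mem <;> split_ifs <;> (try simp) <;>
    exact mul_mem_span₂ (by omega) (by omega) (by omega)

lemma shift_mul_mem_span₃ {p t a b c s s' k : ℕ} (hp : 2 + t ≤ p) (ha : 2 ≤ a) (hb : 2 ≤ b)
    (hc : 2 ≤ c) (hs : s' = s + t) (hk : a + b + c + s = k) :
    ι K (shiftVec p t a) * (e K b * e K c) + e K a * (ι K (shiftVec p t b) * e K c +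
      e K b * ι K (shiftVec p t c)) ∈ span₃ K 2 s' k := by
  apply add_mem
  · rw [ι_shiftVec]
    split_ifs
    · exact mul_mem_span₃ (by omega) hb hc (by omega)
    · simp
  · exact e_mul_mem_span₃ (s := s' + a) ha rfl
      (shift_mul_mem_span₂ (s := s + a) hp hb hc (by omega) (by omega))

lemma IsShiftDerivation.mem_span₂ (hD : IsShiftDerivation D) {s k : ℕ}
    {v : ExteriorAlgebra K (ℕ →₀ K)} (hv : v ∈ span₂ K 2 s k) : D v ∈ span₂ K 2 (s + 1) k := by
  induction hv using Submodule.span_induction with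
  | mem u hu =>
    obtain ⟨a, b, ha, hb, hk, rfl⟩ := hu
    rw [hD.mul, hD.gen a ha, hD.gen b hb]
    exact shift_mul_mem_span₂ le_rfl ha hb rfl hk
  | zero => simp
  | add u v _ _ hu hv => rw [map_add]; exact add_mem hu hv
  | smul t u _ hu => rw [map_smul]; exact Submodule.smul_mem _ _ hu

lemma IsShiftDerivation.mem_span₃ (hD : IsShiftDerivation D) {s k : ℕ}
    {v : ExteriorAlgebra K (ℕ →₀ K)} (hv : v ∈ span₃ K 2 s k) : D v ∈ span₃ K 2 (s + 1) k := by
  induction hv using Submodule.span_induction with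
  | mem u hu =>
    obtain ⟨a, b, c, ha, hb, hc, hk, rfl⟩ := hu
    rw [hD.mul, hD.mul, hD.gen a ha, hD.gen b hb, hD.gen c hc]
    exact shift_mul_mem_span₃ le_rfl ha hb hc rfl hk
  | zero => simp
  | add u v _ _ hu hv => rw [map_add]; exact add_mem hu hv
  | smul t u _ hu => rw [map_smul]; exact Submodule.smul_mem _ _ hu

lemma IsShiftDerivation.coef₂ (hD : IsShiftDerivation D) {s k y z : ℕ} (hy : 2 ≤ y) (hz : 2 ≤ z)
    {v : ExteriorAlgebra K (ℕ →₀ K)} (hv : v ∈ span₂ K 2 s k) :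
    coef₂ y z (D v) = coef₂ (y + 1) z v + coef₂ y (z + 1) v := by
  induction hv using Submodule.span_induction with
  | mem u hu =>
    obtain ⟨a, b, ha, hb, hk, rfl⟩ := hu
    rw [hD.mul, hD.gen a ha, hD.gen b hb]
    simp only [e_eq_ι_vec, map_add, coef₂_ι_mul_ι]
    simp only [coord_shiftVec_one hy ha, coord_shiftVec_one hy hb, coord_shiftVec_one hz ha,
      coord_shiftVec_one hz hb]
    ring
  | zero => simp
  | add u v _ _ hu hv => simp only [map_add, hu, hv]; ring
  | smul t u _ hu => simp only [map_smul, hu, smul_add]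

lemma IsShiftDerivation.coef₃ (hD : IsShiftDerivation D) {s k x y z : ℕ} (hx : 2 ≤ x)
    (hy : 2 ≤ y) (hz : 2 ≤ z) {v : ExteriorAlgebra K (ℕ →₀ K)} (hv : v ∈ span₃ K 2 s k) :
    coef₃ x y z (D v) = coef₃ (x + 1) y z v + coef₃ x (y + 1) z v + coef₃ x y (z + 1) v := by
  induction hv using Submodule.span_induction with
  | mem u hu =>
    obtain ⟨a, b, c, ha, hb, hc, hk, rfl⟩ := hu
    rw [hD.mul, hD.mul, hD.gen a ha, hD.gen b hb, hD.gen c hc]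
    simp only [e_eq_ι_vec, map_add, coef₃_ι_mul, coef₂_ι_mul_ι]
    simp only [coord_shiftVec_one hx ha, coord_shiftVec_one hx hb, coord_shiftVec_one hx hc,
      coord_shiftVec_one hy ha, coord_shiftVec_one hy hb, coord_shiftVec_one hy hc,
      coord_shiftVec_one hz ha, coord_shiftVec_one hz hb, coord_shiftVec_one hz hc]
    ring
  | zero => simp
  | add u v _ _ hu hv => simp only [map_add, hu, hv]; ring
  | smul t u _ hu => simp only [map_smul, hu, smul_add]

lemma exists_differential_eq₂ (hd : IsCEDifferential d) (hD : IsShiftDerivation D) {s k : ℕ}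
    {v : ExteriorAlgebra K (ℕ →₀ K)} (hv : v ∈ span₂ K 2 s k) :
    ∃ v' ∈ span₂ K 2 (s + 2) k, d v = e K 1 * D v + e K 2 * v' ∧
      ∀ y z, 3 ≤ y → 3 ≤ z → coef₂ y z v' = coef₂ (y + 2) z v + coef₂ y (z + 2) v := by
  induction hv using Submodule.span_induction with
  | mem u hu =>
    obtain ⟨a, b, ha, hb, hk, rfl⟩ := hu
    refine ⟨ι K (shiftVec 5 2 a) * e K b + e K a * ι K (shiftVec 5 2 b),
      shift_mul_mem_span₂ (by norm_num) ha hb rfl hk, ?_, ?_⟩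
    · rw [hd.mul a (by omega), hd.gen a ha, hd.gen b hb, hD.mul, hD.gen a ha, hD.gen b hb]
      simp only [e_eq_ι_vec, add_mul, mul_add, mul_assoc]
      rw [ι_mul_ι_mul_comm (vec a) (vec 1), ι_mul_ι_mul_comm (vec a) (vec 2)]
      abel
    · intro y z hy hz
      simp only [e_eq_ι_vec, map_add, coef₂_ι_mul_ι]
      simp only [coord_shiftVec_two hy ha, coord_shiftVec_two hy hb, coord_shiftVec_two hz ha,
        coord_shiftVec_two hz hb]
      ring
  | zero => exact ⟨0, zero_mem _, by simp, by simp⟩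
  | add u v _ _ hu hv =>
    obtain ⟨u', hu', hu₁, hu₂⟩ := hu
    obtain ⟨v', hv', hv₁, hv₂⟩ := hv
    refine ⟨u' + v', add_mem hu' hv', ?_, fun y z hy hz => ?_⟩
    · simp only [map_add, hu₁, hv₁, mul_add]; abel
    · simp only [map_add, hu₂ y z hy hz, hv₂ y z hy hz]; ring
  | smul t u _ hu =>
    obtain ⟨u', hu', hu₁, hu₂⟩ := hu
    refine ⟨t • u', Submodule.smul_mem _ _ hu', ?_, fun y z hy hz => ?_⟩
    · simp only [map_smul, hu₁, smul_add, mul_smul_comm]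
    · simp only [map_smul, hu₂ y z hy hz, smul_add]

lemma exists_differential_eq₃ (hd : IsCEDifferential d) (hD : IsShiftDerivation D) {s k : ℕ}
    {v : ExteriorAlgebra K (ℕ →₀ K)} (hv : v ∈ span₃ K 2 s k) :
    ∃ v' ∈ span₃ K 2 (s + 2) k, d v = e K 1 * D v + e K 2 * v' ∧
      ∀ x y z, 3 ≤ x → 3 ≤ y → 3 ≤ z → coef₃ x y z v' =
        coef₃ (x + 2) y z v + coef₃ x (y + 2) z v + coef₃ x y (z + 2) v := by
  induction hv using Submodule.span_induction with
  | mem u hu =>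
    obtain ⟨a, b, c, ha, hb, hc, hk, rfl⟩ := hu
    refine ⟨ι K (shiftVec 5 2 a) * (e K b * e K c) + e K a * (ι K (shiftVec 5 2 b) * e K c +
      e K b * ι K (shiftVec 5 2 c)), shift_mul_mem_span₃ (by norm_num) ha hb hc rfl hk, ?_, ?_⟩
    · rw [hd.mul a (by omega), hd.mul b (by omega), hd.gen a ha, hd.gen b hb, hd.gen c hc, hD.mul,
        hD.mul, hD.gen a ha, hD.gen b hb, hD.gen c hc]
      simp only [e_eq_ι_vec, add_mul, mul_add, mul_sub, mul_assoc]
      rw [ι_mul_ι_mul_comm (vec b) (vec 1), ι_mul_ι_mul_comm (vec b) (vec 2), mul_neg, mul_neg,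
        ι_mul_ι_mul_comm (vec a) (vec 1), ι_mul_ι_mul_comm (vec a) (vec 2),
        ι_mul_ι_mul_comm (vec a) (vec 1), ι_mul_ι_mul_comm (vec a) (vec 2)]
      abel
    · intro x y z hx hy hz
      simp only [e_eq_ι_vec, map_add, coef₃_ι_mul, coef₂_ι_mul_ι]
      simp only [coord_shiftVec_two hx ha, coord_shiftVec_two hx hb, coord_shiftVec_two hx hc,
        coord_shiftVec_two hy ha, coord_shiftVec_two hy hb, coord_shiftVec_two hy hc,
        coord_shiftVec_two hz ha, coord_shiftVec_two hz hb, coord_shiftVec_two hz hc]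
      ring
  | zero => exact ⟨0, zero_mem _, by simp, by simp⟩
  | add u v _ _ hu hv =>
    obtain ⟨u', hu', hu₁, hu₂⟩ := hu
    obtain ⟨v', hv', hv₁, hv₂⟩ := hv
    refine ⟨u' + v', add_mem hu' hv', ?_, fun x y z hx hy hz => ?_⟩
    · simp only [map_add, hu₁, hv₁, mul_add]; abel
    · simp only [map_add, hu₂ x y z hx hy hz, hv₂ x y z hx hy hz]; ring
  | smul t u _ hu =>
    obtain ⟨u', hu', hu₁, hu₂⟩ := hu
    refine ⟨t • u', Submodule.smul_mem _ _ hu', ?_, fun x y z hx hy hz => ?_⟩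
    · simp only [map_smul, hu₁, smul_add, mul_smul_comm]
    · simp only [map_smul, hu₂ x y z hx hy hz, smul_add]

end Derivations

section CoefficientFunctions

/-- Alternating functions of three natural numbers. -/
structure IsAlternating₃ (f : ℕ → ℕ → ℕ → K) : Prop where
  swap_left : ∀ x y z, f y x z = -f x y z
  swap_right : ∀ x y z, f x z y = -f x y z
  self_left : ∀ x z, f x x z = 0

variable {f : ℕ → ℕ → ℕ → K}

lemma isAlternating₃_coef₃ (u : ExteriorAlgebra K (ℕ →₀ K)) :
    IsAlternating₃ fun x y z => coef₃ x y z u :=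
  ⟨fun _ _ _ => coef₃_swap_left _ _ _ _, fun _ _ _ => coef₃_swap_right _ _ _ _,
    fun _ _ => coef₃_self_left _ _ _⟩

lemma IsAlternating₃.self_outer (hf : IsAlternating₃ f) (x y : ℕ) : f x y x = 0 := by
  rw [hf.swap_right, hf.self_left, neg_zero]

lemma IsAlternating₃.self_right (hf : IsAlternating₃ f) (x y : ℕ) : f x y y = 0 := by
  rw [hf.swap_left, hf.self_outer, neg_zero]

lemma IsAlternating₃.eq_zero_of_sorted (hf : IsAlternating₃ f) {r : ℕ}
    (h : ∀ x y z, r ≤ x → x < y → y < z → f x y z = 0) {x y z : ℕ} (hx : r ≤ x) (hy : r ≤ y)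
    (hz : r ≤ z) : f x y z = 0 := by
  have h' : ∀ x y z, r ≤ x → r ≤ y → y < z → f x y z = 0 := by
    intro x y z hx hy hyz
    rcases lt_trichotomy x y with hxy | rfl | hxy
    · exact h x y z hx hxy hyz
    · exact hf.self_left _ _
    · rw [hf.swap_left y x]
      rcases lt_trichotomy x z with hxz | rfl | hxz
      · rw [h y x z hy hxy hxz, neg_zero]
      · rw [hf.self_right, neg_zero]
      · rw [hf.swap_right y z x, h y z x hy hyz hxz, neg_zero, neg_zero]
  rcases lt_trichotomy y z with hyz | rfl | hyz
  · exact h' x y z hx hy hyz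
  · exact hf.self_right _ _
  · rw [hf.swap_right x z y, h' x z y hx hz hyz, neg_zero]

/-- An alternating function killed by the first two power sums of the shifts is determined by its
values at `(j, j + 1, j + 2)`. -/
lemma IsAlternating₃.eq_zero_of_power_sums (hf : IsAlternating₃ f) {r : ℕ}
    (h₁ : ∀ x y z, r ≤ x → r ≤ y → r ≤ z →
      f (x + 1) y z + f x (y + 1) z + f x y (z + 1) = 0)
    (h₂ : ∀ x y z, r ≤ x → r ≤ y → r ≤ z →
      f (x + 2) y z + f x (y + 2) z + f x y (z + 2) = 0)
    (h₀ : ∀ j, r ≤ j → f j (j + 1) (j + 2) = 0) {x y z : ℕ} (hx : r ≤ x) (hy : r ≤ y)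
    (hz : r ≤ z) : f x y z = 0 := by
  have cube (x y z : ℕ) (hx : r ≤ x) (hy : r ≤ y) (hz : r ≤ z) :
      f (x + 3) y z = f (x + 1) (y + 1) (z + 1) := by
    have a₁ := h₁ (x + 2) y z (by omega) hy hz
    have a₂ := h₁ (x + 1) (y + 1) z (by omega) (by omega) hz
    have a₃ := h₁ (x + 1) y (z + 1) (by omega) hy (by omega)
    have a₄ := h₂ (x + 1) y z (by omega) hy hz
    simp only [add_assoc, Nat.reduceAdd] at a₁ a₂ a₃ a₄ ⊢
    linear_combination a₁ / 2 - a₂ / 2 - a₃ / 2 + a₄ / 2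
  have key : ∀ n m, r ≤ m → ∀ x y z, m ≤ x → x < y → y < z → z ≤ m + n → f x y z = 0 := by
    intro n
    induction n with
    | zero => intro m _ x y z; omega
    | succ n ih =>
      intro m hm x y z hx hxy hyz hz
      by_cases hclose : z ≤ x + 2
      · obtain rfl : y = x + 1 := by omega
        obtain rfl : z = x + 2 := by omega
        exact h₀ x (by omega)
      · obtain ⟨t, rfl⟩ : ∃ t, z = t + 3 := ⟨z - 3, by omega⟩
        rw [hf.swap_right x (t + 3) y, hf.swap_left (t + 3) x y, neg_neg,
          cube t x y (by omega) (by omega) (by omega)]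
        have hg : ∀ a b c, m + 1 ≤ a → a < b → b < c → f a b c = 0 ∨ m + n + 1 < c := by
          intro a b c ha hab hbc
          by_cases hc : c ≤ m + 1 + n
          · exact Or.inl (ih (m + 1) (by omega) a b c ha hab hbc hc)
          · right; omega
        rcases lt_trichotomy (t + 1) (y + 1) with h | h | h
        · rw [hf.swap_right (t + 1) (y + 1) (x + 1), hf.swap_left (y + 1)]
          rcases lt_trichotomy (t + 1) (x + 1) with h' | h' | h'
          · omega
          · rw [h', hf.self_right]; simp
          · rw [hf.swap_right (y + 1) (x + 1) (t + 1), hf.swap_left (x + 1) (y + 1),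
              hf.swap_right (x + 1) (t + 1) (y + 1)]
            rcases hg (x + 1) (t + 1) (y + 1) (by omega) h' h with h | h
            · rw [h]; simp
            · omega
        · rw [h, hf.self_outer]
        · rw [hf.swap_left (x + 1) (t + 1), hf.swap_right (x + 1) (y + 1) (t + 1), neg_neg]
          rcases hg (x + 1) (y + 1) (t + 1) (by omega) (by omega) h with h | h
          · exact h
          · omega
  exact hf.eq_zero_of_sorted (fun x y z hx hxy hyz => key z x hx x y z le_rfl hxy hyz (by omega))
    hx hy hz

/-- An alternating function killed by the sum of the shifts is determined by its values at
`(x, y, y + 1)`. -/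
lemma IsAlternating₃.eq_zero_of_sum_shift (hf : IsAlternating₃ f) {r : ℕ}
    (h₁ : ∀ x y z, r ≤ x → r ≤ y → r ≤ z →
      f (x + 1) y z + f x (y + 1) z + f x y (z + 1) = 0)
    (h₀ : ∀ x y, r ≤ x → x < y → f x y (y + 1) = 0) {x y z : ℕ} (hx : r ≤ x) (hy : r ≤ y)
    (hz : r ≤ z) : f x y z = 0 := by
  have key : ∀ n x y, r ≤ x → x < y → f x y (y + 1 + n) = 0 := by
    intro n
    induction n using Nat.strong_induction_on with
    | _ n ih =>
      intro x y hx hxy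
      rcases n with _ | n
      · exact h₀ x y hx hxy
      · have h := h₁ x y (y + 1 + n) hx (by omega) (by omega)
        have ha : f (x + 1) y (y + 1 + n) = 0 := by
          rcases Nat.lt_or_ge (x + 1) y with h' | h'
          · exact ih n (by omega) (x + 1) y (by omega) h'
          · rw [show y = x + 1 by omega, hf.self_left]
        have hb : f x (y + 1) (y + 1 + n) = 0 := by
          rcases n with _ | n
          · exact hf.self_right _ _
          · rw [show y + 1 + (n + 1) = y + 1 + 1 + n by omega]
            exact ih n (by omega) x (y + 1) hx (by omega)
        rw [ha, hb, zero_add, zero_add] at h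
        exact h
  refine hf.eq_zero_of_sorted (fun x y z hx hxy hyz => ?_) hx hy hz
  rw [show z = y + 1 + (z - y - 1) by omega]
  exact key _ x y hx hxy

/-- The sign of the triple of residues `(x, y, z)` as a permutation of `ZMod 3`, or zero. -/
def residueSign (x y z : ZMod 3) : ℤ :=
  if (y - x) * (z - y) * (z - x) = 0 then 0
  else if (y - x) * (z - y) * (z - x) = 1 then -1 else 1

variable (K) in
/-- The coefficients of the generating cocycle of weight `k`, for `k` divisible by `3`. -/
def signCoef (k x y z : ℕ) : K := if x + y + z = k then (residueSign x y z : K) else 0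

lemma isAlternating₃_signCoef (k : ℕ) : IsAlternating₃ (signCoef K k) := by
  refine ⟨fun x y z => ?_, fun x y z => ?_, fun x z => ?_⟩
  · have : ∀ x y z, residueSign y x z = -residueSign x y z := by decide
    rw [signCoef, signCoef, this, add_comm y x]
    split_ifs <;> simp
  · have : ∀ x y z, residueSign x z y = -residueSign x y z := by decide
    rw [signCoef, signCoef, this, add_right_comm]
    split_ifs <;> simp
  · have : ∀ x z, residueSign x x z = 0 := by decide
    simp [signCoef, this]

lemma signCoef_sum_shift_one (j x y z : ℕ) :
    signCoef K (3 * j + 3) (x + 1) y z + signCoef K (3 * j + 3) x (y + 1) z +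
      signCoef K (3 * j + 3) x y (z + 1) = 0 := by
  have key : ∀ x y z : ZMod 3, x + y + z + 1 = 0 →
    residueSign (x + 1) y z + residueSign x (y + 1) z + residueSign x y (z + 1) = 0 := by decide
  simp only [signCoef]
  by_cases h : x + y + z + 1 = 3 * j + 3
  · rw [if_pos (by omega), if_pos (by omega), if_pos (by omega)]
    have h3 : ((3 * j + 3 : ℕ) : ZMod 3) = 0 := by
      rw [ZMod.natCast_eq_zero_iff]; omega
    rw [← h] at h3
    push_cast at h3
    exact_mod_cast key x y z h3
  · rw [if_neg (by omega), if_neg (by omega), if_neg (by omega)]; simp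

lemma signCoef_sum_shift_two (j x y z : ℕ) :
    signCoef K (3 * j + 3) (x + 2) y z + signCoef K (3 * j + 3) x (y + 2) z +
      signCoef K (3 * j + 3) x y (z + 2) = 0 := by
  have key : ∀ x y z : ZMod 3, x + y + z + 2 = 0 →
    residueSign (x + 2) y z + residueSign x (y + 2) z + residueSign x y (z + 2) = 0 := by decide
  simp only [signCoef]
  by_cases h : x + y + z + 2 = 3 * j + 3
  · rw [if_pos (by omega), if_pos (by omega), if_pos (by omega)]
    have h3 : ((3 * j + 3 : ℕ) : ZMod 3) = 0 := by
      rw [ZMod.natCast_eq_zero_iff]; omega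
    rw [← h] at h3
    push_cast at h3
    exact_mod_cast key x y z h3
  · rw [if_neg (by omega), if_neg (by omega), if_neg (by omega)]; simp

lemma signCoef_succ (j x y : ℕ) :
    signCoef K (3 * j + 3) x y (y + 1) = if x + y + (y + 1) = 3 * j + 3 then 1 else 0 := by
  have key : ∀ x y : ZMod 3, x + y + (y + 1) = 0 → residueSign x y (y + 1) = 1 := by decide
  rw [signCoef]
  split_ifs with h
  · have h3 : ((3 * j + 3 : ℕ) : ZMod 3) = 0 := by
      rw [ZMod.natCast_eq_zero_iff]; omega
    rw [← h] at h3
    push_cast at h3 ⊢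
    exact_mod_cast key x y h3
  · rfl

end CoefficientFunctions

section Cocycles

open ExteriorAlgebra

variable {d D : Module.End K (ExteriorAlgebra K (ℕ →₀ K))}

/-- The cochain `ω(e^p ∧ e^q ∧ e^{q+1})`, with the sum truncated to `n` terms. -/
noncomputable def omegaCochain (D : Module.End K (ExteriorAlgebra K (ℕ →₀ K))) (n p q : ℕ) :
    ExteriorAlgebra K (ℕ →₀ K) :=
  ∑ m ∈ Finset.range n, (-1 : K) ^ m • ((D ^ m) (e K p * e K q) * e K (q + 1 + m))

lemma IsShiftDerivation.pow_mem (hD : IsShiftDerivation D) {p q : ℕ} (hp : 2 ≤ p) (hq : 2 ≤ q)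
    (hpq : p ≤ q) (m : ℕ) :
    (D ^ m) (e K p * e K q) ∈ Submodule.span K {x | ∃ a b, 2 ≤ a ∧ 2 ≤ b ∧ a ≤ q ∧ b ≤ q ∧
      a + b + m = p + q ∧ x = e K a * e K b} := by
  induction m with
  | zero => exact Submodule.subset_span ⟨p, q, hp, hq, hpq, le_rfl, rfl, by simp⟩
  | succ m ih =>
    rw [pow_succ', Module.End.mul_apply]
    generalize (D ^ m) (e K p * e K q) = v at ih
    induction ih using Submodule.span_induction with
    | mem u hu =>
      obtain ⟨a, b, ha, hb, haq, hbq, hk, rfl⟩ := hu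
      rw [hD.mul, hD.gen a ha, hD.gen b hb, ι_shiftVec, ι_shiftVec]
      apply add_mem <;> split_ifs
      · exact Submodule.subset_span ⟨a - 1, b, by omega, hb, by omega, hbq, by omega, rfl⟩
      · simp
      · exact Submodule.subset_span ⟨a, b - 1, ha, by omega, haq, by omega, by omega, rfl⟩
      · simp
    | zero => simp
    | add u v _ _ hu hv => rw [map_add]; exact add_mem hu hv
    | smul t u _ hu => rw [map_smul]; exact Submodule.smul_mem _ _ hu

lemma IsShiftDerivation.pow_mem_span₂ (hD : IsShiftDerivation D) {p q : ℕ} (hp : 2 ≤ p)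
    (hq : 2 ≤ q) (hpq : p ≤ q) (m : ℕ) :
    (D ^ m) (e K p * e K q) ∈ span₂ K 2 m (p + q) := by
  refine Submodule.span_mono ?_ (hD.pow_mem hp hq hpq m)
  rintro x ⟨a, b, ha, hb, -, -, hk, rfl⟩
  exact ⟨a, b, ha, hb, hk, rfl⟩

lemma IsShiftDerivation.pow_eq_zero (hD : IsShiftDerivation D) {p q m : ℕ} (hp : 2 ≤ p)
    (hq : 2 ≤ q) (hpq : p ≤ q) (hm : p + q ≤ m) : (D ^ m) (e K p * e K q) = 0 := by
  have := hD.pow_mem_span₂ hp hq hpq m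
  rw [span₂, Set.eq_empty_of_forall_notMem (s := {x | _}) , Submodule.span_empty] at this
  · simpa using this
  · rintro x ⟨a, b, ha, hb, hk, -⟩
    omega

lemma IsShiftDerivation.omegaCochain_mem (hD : IsShiftDerivation D) {n p q k : ℕ} (hp : 2 ≤ p)
    (hq : 2 ≤ q) (hpq : p ≤ q) (hk : p + q + (q + 1) = k) :
    omegaCochain D n p q ∈ span₃ K 2 0 k := by
  refine Submodule.sum_mem _ fun m _ => Submodule.smul_mem _ _ ?_
  have h := hD.pow_mem_span₂ hp hq hpq m
  generalize (D ^ m) (e K p * e K q) = v at h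
  induction h using Submodule.span_induction with
  | mem u hu =>
    obtain ⟨a, b, ha, hb, hs, rfl⟩ := hu
    rw [mul_assoc]
    exact mul_mem_span₃ ha hb (by omega) (by omega)
  | zero => simp
  | add u v _ _ hu hv => rw [add_mul]; exact add_mem hu hv
  | smul t u _ hu => rw [smul_mul_assoc]; exact Submodule.smul_mem _ _ hu

lemma IsShiftDerivation.map_omegaCochain (hD : IsShiftDerivation D) {n p q : ℕ} (hp : 2 ≤ p)
    (hq : 2 ≤ q) (hpq : p ≤ q) (hn : p + q ≤ n) : D (omegaCochain D n p q) = 0 := by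
  have key (m : ℕ) : D ((-1 : K) ^ m • ((D ^ m) (e K p * e K q) * e K (q + 1 + m))) =
      (-1 : K) ^ m • ((D ^ m) (e K p * e K q) * e K (q + m)) -
        (-1 : K) ^ (m + 1) • ((D ^ (m + 1)) (e K p * e K q) * e K (q + (m + 1))) := by
    rw [map_smul, hD.mul, hD.gen (q + 1 + m) (by omega), ι_shiftVec, if_pos (by omega),
      show q + 1 + m - 1 = q + m by omega, show q + 1 + m = q + (m + 1) by omega, pow_succ' D,
      Module.End.mul_apply, pow_succ (-1 : K)]
    module
  rw [omegaCochain, map_sum, Finset.sum_congr rfl fun m _ => key m,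
    Finset.sum_range_sub' fun m => (-1 : K) ^ m • ((D ^ m) (e K p * e K q) * e K (q + m)),
    hD.pow_eq_zero hp hq hpq hn]
  simp [mul_assoc, e_mul_self]

lemma coef₃_omegaCochain (hD : IsShiftDerivation D) {n p q x y : ℕ}
    (hp : 2 ≤ p) (hpq : p < q) (hn : 0 < n) (hx : 2 ≤ x) (hxy : x < y) :
    coef₃ x y (y + 1) (omegaCochain D n p q) = if x = p ∧ y = q then 1 else 0 := by
  have coef (a b c : ℕ) (ha : 2 ≤ a) (hb : 2 ≤ b) (hac : a < c) (hbc : b < c) :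
      coef₃ x y (y + 1) (e K a * (e K b * e K c)) =
        (if x = a ∧ y = b ∧ y + 1 = c then 1 else 0) -
          (if x = b ∧ y = a ∧ y + 1 = c then 1 else 0) := by
    have h₁ : coef₂ (K := K) y (y + 1) (e K b * e K c) = if y = b ∧ y + 1 = c then 1 else 0 := by
      rw [coef₂_e_mul_e (by omega) (by omega) (by omega) (by omega), ← ite_and, ← ite_and,
        if_neg (c := y + 1 = b ∧ y = c) (by omega), sub_zero]
    have h₂ (h : y = a) :
        coef₂ (K := K) x (y + 1) (e K b * e K c) = if x = b ∧ y + 1 = c then 1 else 0 := by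
      rw [coef₂_e_mul_e (by omega) (by omega) (by omega) (by omega), ← ite_and, ← ite_and,
        if_neg (c := y + 1 = b ∧ x = c) (by omega), sub_zero]
    have h₃ (h : y + 1 = a) : coef₂ (K := K) x y (e K b * e K c) = 0 := by
      rw [coef₂_e_mul_e (by omega) (by omega) (by omega) (by omega), ← ite_and, ← ite_and,
        if_neg (by omega), if_neg (by omega), sub_zero]
    rw [coef₃_e_mul (by omega) (by omega) (by omega) (by omega), ite_eq_right_iff.mpr h₃,
      add_zero, h₁, ← ite_and]
    congr 1
    by_cases h : y = a
    · rw [if_pos h, h₂ h]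
      simp only [h, true_and]
    · rw [if_neg h, if_neg fun h' => h h'.2.1]
  rw [omegaCochain, map_sum, Finset.sum_eq_single_of_mem 0 (by simpa using hn)]
  · rw [pow_zero, one_smul, pow_zero, Module.End.one_apply, mul_assoc,
      coef _ _ _ (by omega) (by omega) (by omega) (by omega)]
    split_ifs <;> first | omega | simp
  · intro m _ hm
    rw [map_smul]
    have h := hD.pow_mem hp (by omega) hpq.le m
    generalize (D ^ m) (e K p * e K q) = v at h
    suffices coef₃ x y (y + 1) (v * e K (q + 1 + m)) = 0 by rw [this, smul_zero]
    induction h using Submodule.span_induction with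
    | mem u hu =>
      obtain ⟨a, b, ha, hb, haq, hbq, hk, rfl⟩ := hu
      rw [mul_assoc, coef _ _ _ (by omega) (by omega) (by omega) (by omega), if_neg (by omega),
        if_neg (by omega), sub_zero]
    | zero => simp
    | add u v _ _ hu hv => rw [add_mul, map_add, hu, hv, add_zero]
    | smul t u _ hu => rw [smul_mul_assoc, map_smul, hu, smul_zero]

/-- The cochain `w_{j,j+1,j+2}`. -/
noncomputable def basicCocycle (D : Module.End K (ExteriorAlgebra K (ℕ →₀ K))) (j : ℕ) :
    ExteriorAlgebra K (ℕ →₀ K) :=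
  ∑ l ∈ Finset.range ((j - 2) / 2 + 1), omegaCochain D (2 * j + 2) (j - 2 * l) (j + 1 + l)

lemma basicCocycle_mem (hD : IsShiftDerivation D) {j : ℕ} (hj : 2 ≤ j) :
    basicCocycle D j ∈ span₃ K 2 0 (3 * j + 3) := by
  refine Submodule.sum_mem _ fun l hl => ?_
  rw [Finset.mem_range] at hl
  exact hD.omegaCochain_mem (by omega) (by omega) (by omega) (by omega)

lemma map_basicCocycle (hD : IsShiftDerivation D) {j : ℕ} (hj : 2 ≤ j) :
    D (basicCocycle D j) = 0 := by
  rw [basicCocycle, map_sum]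
  refine Finset.sum_eq_zero fun l hl => ?_
  rw [Finset.mem_range] at hl
  exact hD.map_omegaCochain (by omega) (by omega) (by omega) (by omega)

lemma coef₃_basicCocycle (hD : IsShiftDerivation D) {j x y z : ℕ} (hj : 2 ≤ j) (hx : 2 ≤ x)
    (hy : 2 ≤ y) (hz : 2 ≤ z) :
    coef₃ x y z (basicCocycle D j) = signCoef K (3 * j + 3) x y z := by
  have hmem := basicCocycle_mem hD hj
  have alt₁ := isAlternating₃_coef₃ (basicCocycle D j)
  have alt₂ := isAlternating₃_signCoef (K := K) (3 * j + 3)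
  have alt : IsAlternating₃ fun x y z =>
      coef₃ x y z (basicCocycle D j) - signCoef K (3 * j + 3) x y z := by
    refine ⟨fun x y z => ?_, fun x y z => ?_, fun x z => ?_⟩
    · rw [coef₃_swap_left x y, alt₂.swap_left x y]; ring
    · rw [coef₃_swap_right x y, alt₂.swap_right x y]; ring
    · rw [coef₃_self_left, alt₂.self_left, sub_zero]
  refine sub_eq_zero.mp (alt.eq_zero_of_sum_shift (r := 2) ?_ ?_ hx hy hz)
  · intro x y z hx hy hz
    have h := hD.coef₃ hx hy hz hmem
    rw [map_basicCocycle hD hj, map_zero] at h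
    linear_combination -h - signCoef_sum_shift_one (K := K) j x y z
  · intro x y hx hxy
    rw [signCoef_succ]
    split_ifs with h
    · have hl : y - (j + 1) ∈ Finset.range ((j - 2) / 2 + 1) := by rw [Finset.mem_range]; omega
      rw [basicCocycle, map_sum, Finset.sum_eq_single_of_mem _ hl]
      · rw [Finset.mem_range] at hl
        rw [coef₃_omegaCochain hD (by omega) (by omega) (by omega) hx hxy, if_pos (by omega),
          sub_self]
      · intro l hl' hne
        rw [Finset.mem_range] at hl'
        rw [coef₃_omegaCochain hD (by omega) (by omega) (by omega) hx hxy, if_neg (by omega)]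
    · rw [coef₃_eq_zero (by norm_num) (by omega) (by omega) (by omega) hmem (by omega), sub_zero]

lemma differential_basicCocycle (hd : IsCEDifferential d) (hD : IsShiftDerivation D) {j : ℕ}
    (hj : 2 ≤ j) : d (basicCocycle D j) = 0 := by
  obtain ⟨u, hu, hdu, hcoef⟩ := exists_differential_eq₃ hd hD (basicCocycle_mem hD hj)
  rw [hdu, map_basicCocycle hD hj, mul_zero, zero_add]
  refine e_two_mul_eq_zero hu fun x y z hx hy hz => ?_
  rw [hcoef x y z hx hy hz, coef₃_basicCocycle hD hj (by omega) (by omega) (by omega),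
    coef₃_basicCocycle hD hj (by omega) (by omega) (by omega),
    coef₃_basicCocycle hD hj (by omega) (by omega) (by omega), signCoef_sum_shift_two]

end Cocycles

section Coboundaries

open ExteriorAlgebra

variable {d D : Module.End K (ExteriorAlgebra K (ℕ →₀ K))}

lemma IsShiftDerivation.exists_map_eq_mul (hD : IsShiftDerivation D) {a b : ℕ} (ha : 2 ≤ a)
    (hb : 2 ≤ b) : ∃ x ∈ span₂ K 2 0 (a + b + 1), D x = e K a * e K b := by
  induction a, ha using Nat.le_induction generalizing b with
  | base =>
    refine ⟨e K 2 * e K (b + 1), mul_mem_span₂ le_rfl (by omega) (by omega), ?_⟩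
    rw [hD.mul, hD.gen 2 le_rfl, hD.gen (b + 1) (by omega), ι_shiftVec, ι_shiftVec,
      if_neg (by omega), if_pos (by omega), zero_mul, zero_add, Nat.add_sub_cancel]
  | succ a ha ih =>
    obtain ⟨x, hx, hDx⟩ := ih (b := b + 1) (by omega)
    refine ⟨e K (a + 1) * e K (b + 1) - x,
      sub_mem (mul_mem_span₂ (by omega) (by omega) (by omega)) ?_, ?_⟩
    · rwa [show a + 1 + b + 1 = a + (b + 1) + 1 by omega]
    · rw [map_sub, hDx, hD.mul, hD.gen (a + 1) (by omega), hD.gen (b + 1) (by omega), ι_shiftVec,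
        ι_shiftVec, if_pos (by omega), if_pos (by omega), Nat.add_sub_cancel, Nat.add_sub_cancel,
        add_sub_cancel_left]

lemma IsShiftDerivation.exists_map_eq (hD : IsShiftDerivation D) {k : ℕ}
    {v : ExteriorAlgebra K (ℕ →₀ K)} (hv : v ∈ span₂ K 2 1 k) :
    ∃ x ∈ span₂ K 2 0 k, D x = v := by
  induction hv using Submodule.span_induction with
  | mem u hu =>
    obtain ⟨a, b, ha, hb, rfl, rfl⟩ := hu
    exact hD.exists_map_eq_mul ha hb
  | zero => exact ⟨0, zero_mem _, map_zero _⟩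
  | add u v _ _ hu hv =>
    obtain ⟨x, hx, rfl⟩ := hu
    obtain ⟨y, hy, rfl⟩ := hv
    exact ⟨x + y, add_mem hx hy, map_add _ _ _⟩
  | smul t u _ hu =>
    obtain ⟨x, hx, rfl⟩ := hu
    exact ⟨t • x, Submodule.smul_mem _ _ hx, map_smul _ _ _⟩

lemma IsCEDifferential.e_mem (hd : IsCEDifferential d) {a s k : ℕ} (ha : 1 ≤ a)
    (hk : a + s = k) : d (e K a) ∈ span₂ K 1 s k := by
  obtain rfl | ha : a = 1 ∨ 2 ≤ a := by omega
  · rw [hd.one]; exact zero_mem _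
  · rw [hd.gen a ha, ι_shiftVec, ι_shiftVec]
    apply add_mem <;> split_ifs <;> (try simp) <;>
      exact mul_mem_span₂ (by omega) (by omega) (by omega)

lemma IsCEDifferential.map_mul (hd : IsCEDifferential d) {s k : ℕ}
    {v : ExteriorAlgebra K (ℕ →₀ K)} (hv : v ∈ span₂ K 1 s k) (y : ExteriorAlgebra K (ℕ →₀ K)) :
    d (v * y) = d v * y + v * d y := by
  induction hv using Submodule.span_induction with
  | mem u hu =>
    obtain ⟨a, b, ha, hb, -, rfl⟩ := hu
    rw [mul_assoc, hd.mul a ha, hd.mul b hb, hd.mul a ha]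
    simp only [mul_sub, sub_mul, mul_assoc]
    abel
  | zero => simp
  | add u v _ _ hu hv => simp only [add_mul, map_add, hu, hv]; abel
  | smul t u _ hu => simp only [smul_mul_assoc, map_smul, hu, smul_add]

lemma IsCEDifferential.map_map_e (hd : IsCEDifferential d) {a : ℕ} (ha : 1 ≤ a) :
    d (d (e K a)) = 0 := by
  obtain rfl | ha : a = 1 ∨ 2 ≤ a := by omega
  · rw [hd.one, map_zero]
  have h2 : d (e K 2) = 0 := by
    rw [hd.gen 2 le_rfl, ι_shiftVec, ι_shiftVec, if_neg (by omega), if_neg (by omega), mul_zero,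
      mul_zero, add_zero]
  have h21 (b : ExteriorAlgebra K (ℕ →₀ K)) : e K 2 * (e K 1 * b) = -(e K 1 * (e K 2 * b)) :=
    ι_mul_ι_mul_comm _ _ _
  rw [hd.gen a ha, ι_shiftVec, ι_shiftVec]
  split_ifs with h h' h'
  · rw [map_add, hd.mul 1 le_rfl, hd.mul 2 (by norm_num), hd.one, h2, hd.gen (a - 1) (by omega),
      hd.gen (a - 2) (by omega), ι_shiftVec, ι_shiftVec, ι_shiftVec, if_pos (by omega),
      if_pos (c := 3 ≤ a - 2) (by omega)]
    simp only [mul_add, e_mul_self_mul, h21]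
    split_ifs
    · rw [show a - 2 - 1 = a - 1 - 2 by omega]; simp
    · obtain rfl : a = 5 := by omega
      simp [e_mul_self]
  · rw [mul_zero, add_zero, hd.mul 1 le_rfl, hd.one, hd.gen (a - 1) (by omega), ι_shiftVec,
      ι_shiftVec, if_neg (c := 5 ≤ a - 1) (by omega), mul_zero, add_zero, e_mul_self_mul,
      zero_mul, sub_zero]
  · omega
  · simp

lemma IsCEDifferential.mem_span₃ (hd : IsCEDifferential d) {k : ℕ}
    {v : ExteriorAlgebra K (ℕ →₀ K)} (hv : v ∈ span₂ K 1 0 k) : d v ∈ span₃ K 1 0 k := by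
  induction hv using Submodule.span_induction with
  | mem u hu =>
    obtain ⟨a, b, ha, hb, hk, rfl⟩ := hu
    rw [hd.mul a ha]
    exact sub_mem (mul_e_mem_span₃ (s := b) hb (by omega) (hd.e_mem ha (by omega)))
      (e_mul_mem_span₃ (s := a) ha (by omega) (hd.e_mem hb (by omega)))
  | zero => simp
  | add u v _ _ hu hv => rw [map_add]; exact add_mem hu hv
  | smul t u _ hu => rw [map_smul]; exact Submodule.smul_mem _ _ hu

lemma IsCEDifferential.map_map (hd : IsCEDifferential d) {k : ℕ}
    {v : ExteriorAlgebra K (ℕ →₀ K)} (hv : v ∈ span₂ K 1 0 k) : d (d v) = 0 := by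
  induction hv using Submodule.span_induction with
  | mem u hu =>
    obtain ⟨a, b, ha, hb, hk, rfl⟩ := hu
    rw [hd.mul a ha, map_sub, hd.map_mul (hd.e_mem ha (Nat.add_zero a)), hd.mul a ha,
      hd.map_map_e ha, hd.map_map_e hb]
    simp
  | zero => simp
  | add u v _ _ hu hv => rw [map_add, map_add, hu, hv, add_zero]
  | smul t u _ hu => rw [map_smul, map_smul, hu, smul_zero]

lemma coef₃_e_mul_of_ne {x y z a : ℕ} (ha : 1 ≤ a) (hx : a < x) (hy : a < y) (hz : a < z)
    (v : ExteriorAlgebra K (ℕ →₀ K)) : coef₃ x y z (e K a * v) = 0 := by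
  rw [coef₃_e_mul (by omega) (by omega) (by omega) ha, if_neg hx.ne', if_neg hy.ne',
    if_neg hz.ne', sub_zero, add_zero]

lemma IsCEDifferential.coef₃_map (hd : IsCEDifferential d) {k x y z : ℕ} (hx : 3 ≤ x)
    (hy : 3 ≤ y) (hz : 3 ≤ z) {v : ExteriorAlgebra K (ℕ →₀ K)} (hv : v ∈ span₂ K 1 0 k) :
    coef₃ x y z (d v) = 0 := by
  have he {a : ℕ} (ha : 1 ≤ a) : ∃ p q, d (e K a) = e K 1 * p + e K 2 * q := by
    obtain rfl | ha : a = 1 ∨ 2 ≤ a := by omega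
    · exact ⟨0, 0, by rw [hd.one]; simp⟩
    · exact ⟨_, _, hd.gen a ha⟩
  induction hv using Submodule.span_induction with
  | mem u hu =>
    obtain ⟨a, b, ha, hb, -, rfl⟩ := hu
    obtain ⟨p, q, hp⟩ := he ha
    obtain ⟨p', q', hp'⟩ := he hb
    have h₁ (v) : e K a * (e K 1 * v) = -(e K 1 * (e K a * v)) := ι_mul_ι_mul_comm _ _ _
    have h₂ (v) : e K a * (e K 2 * v) = -(e K 2 * (e K a * v)) := ι_mul_ι_mul_comm _ _ _
    have h₃ (v) := coef₃_e_mul_of_ne (x := x) (y := y) (z := z) (K := K) le_rfl (by omega)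
      (by omega) (by omega) v
    have h₄ (v) := coef₃_e_mul_of_ne (x := x) (y := y) (z := z) (a := 2) (K := K) (by norm_num)
      (by omega) (by omega) (by omega) v
    rw [hd.mul a ha, hp, hp']
    simp only [add_mul, mul_add, mul_assoc, h₁, h₂, map_add, map_sub, map_neg, h₃, h₄]
    simp
  | zero => simp
  | add u v _ _ hu hv => rw [map_add, map_add, hu, hv, add_zero]
  | smul t u _ hu => rw [map_smul, map_smul, hu, smul_zero]

lemma exists_eq_add_e_one_mul {k : ℕ} {z : ExteriorAlgebra K (ℕ →₀ K)}
    (hz : z ∈ span₃ K 1 0 k) :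
    ∃ u ∈ span₃ K 2 0 k, ∃ v ∈ span₂ K 2 1 k, z = u + e K 1 * v := by
  induction hz using Submodule.span_induction with
  | mem w hw =>
    obtain ⟨a, b, c, ha, hb, hc, hk, rfl⟩ := hw
    have h₁ (a : ℕ) (v) : e K a * (e K 1 * v) = -(e K 1 * (e K a * v)) := ι_mul_ι_mul_comm _ _ _
    have h₂ (a : ℕ) : e K a * e K 1 = -(e K 1 * e K a) := ι_mul_ι_comm _ _
    have hmem (b c : ℕ) (hb : 1 ≤ b) (hc : 1 ≤ c) (h : 1 + b + c = k) :
        ∃ v ∈ span₂ K 2 1 k, e K 1 * (e K b * e K c) = e K 1 * v := by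
      obtain rfl | hb : b = 1 ∨ 2 ≤ b := by omega
      · exact ⟨0, zero_mem _, by rw [e_mul_self_mul, mul_zero]⟩
      obtain rfl | hc : c = 1 ∨ 2 ≤ c := by omega
      · exact ⟨0, zero_mem _, by rw [h₂, mul_neg, e_mul_self_mul, mul_zero, neg_zero]⟩
      · exact ⟨_, mul_mem_span₂ hb hc (by omega), rfl⟩
    obtain rfl | ha' : a = 1 ∨ 2 ≤ a := by omega
    · obtain ⟨v, hv, h⟩ := hmem b c hb hc (by omega)
      exact ⟨0, zero_mem _, v, hv, by rw [h, zero_add]⟩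
    obtain rfl | hb' : b = 1 ∨ 2 ≤ b := by omega
    · obtain ⟨v, hv, h⟩ := hmem a c ha hc (by omega)
      exact ⟨0, zero_mem _, -v, neg_mem hv, by rw [h₁, h, mul_neg, zero_add]⟩
    obtain rfl | hc' : c = 1 ∨ 2 ≤ c := by omega
    · obtain ⟨v, hv, h⟩ := hmem a b ha hb (by omega)
      exact ⟨0, zero_mem _, v, hv, by rw [h₂, mul_neg, h₁, neg_neg, h, zero_add]⟩
    · exact ⟨_, mul_mem_span₃ ha' hb' hc' hk, 0, zero_mem _, by rw [mul_zero, add_zero]⟩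
  | zero => exact ⟨0, zero_mem _, 0, zero_mem _, by simp⟩
  | add w w' _ _ hw hw' =>
    obtain ⟨u, hu, v, hv, rfl⟩ := hw
    obtain ⟨u', hu', v', hv', rfl⟩ := hw'
    exact ⟨u + u', add_mem hu hu', v + v', add_mem hv hv', by rw [mul_add]; abel⟩
  | smul t w _ hw =>
    obtain ⟨u, hu, v, hv, rfl⟩ := hw
    exact ⟨t • u, Submodule.smul_mem _ _ hu, t • v, Submodule.smul_mem _ _ hv,
      by rw [smul_add, mul_smul_comm]⟩

/-- The coefficients of `p` and `q` in `e^1 ∧ p + e^2 ∧ q`. -/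
lemma coef₃_eq_zero_of_add_eq_zero {s k : ℕ} {p q : ExteriorAlgebra K (ℕ →₀ K)}
    (hq : q ∈ span₃ K 2 s k) (h : e K 1 * p + e K 2 * q = 0) :
    (∀ x y z, 2 ≤ x → 2 ≤ y → 2 ≤ z → coef₃ x y z p = 0) ∧
      ∀ x y z, 3 ≤ x → 3 ≤ y → 3 ≤ z → coef₃ x y z q = 0 := by
  have hc (x y : ℕ) (hx : 1 ≤ x) (hy : 1 ≤ y) : coord (K := K) x (vec y) = if x = y then 1 else 0 :=
    coord_vec hx hy
  constructor
  · intro x y z hx hy hz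
    have h₁ := congrArg (fun w => coef₃ x y z (contr 1 w)) h
    have h₂ {y z : ℕ} (hy : 2 ≤ y) (hz : 2 ≤ z) : coef₂ y z (contr 1 q) = 0 := by
      rw [← coef₃_apply]
      exact coef₃_eq_zero (by norm_num) le_rfl (by omega) (by omega) hq (by omega)
    simp only [map_add, e_eq_ι_vec, contr_mul, map_sub, map_smul, map_zero] at h₁
    rw [hc 1 1 le_rfl le_rfl, hc 1 2 le_rfl (by norm_num), if_pos rfl, if_neg (by norm_num),
      one_smul, zero_smul, ← e_eq_ι_vec, ← e_eq_ι_vec, coef₃_e_mul_of_ne le_rfl hx hy hz,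
      coef₃_e_mul (by omega) (by omega) (by omega) (by omega), h₂ hy hz, h₂ hx hz, h₂ hx hy] at h₁
    simpa using h₁
  · intro x y z hx hy hz
    have h₁ := congrArg (fun w => coef₃ x y z (contr 2 w)) h
    simp only [map_add, e_eq_ι_vec, contr_mul, map_sub, map_smul, map_zero] at h₁
    rw [hc 2 1 (by norm_num) le_rfl, hc 2 2 (by norm_num) (by norm_num), if_pos rfl,
      if_neg (by norm_num), one_smul, zero_smul, ← e_eq_ι_vec, ← e_eq_ι_vec,
      coef₃_e_mul_of_ne le_rfl (by omega) (by omega) (by omega),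
      coef₃_e_mul_of_ne (by norm_num) hx hy hz] at h₁
    simpa using h₁

lemma exists_coef₂_eq_neg_one_pow {k : ℕ} (hk : Odd k) : ∃ v ∈ span₂ K 2 0 k,
    ∀ y z, 2 ≤ y → 2 ≤ z → y + z = k → coef₂ y z v = (-1) ^ y := by
  refine ⟨(1 / 2 : K) • ∑ p ∈ Finset.Icc 2 (k - 2), (-1 : K) ^ p • (e K p * e K (k - p)),
    Submodule.smul_mem _ _ (Submodule.sum_mem _ fun p hp => Submodule.smul_mem _ _ ?_), ?_⟩
  · rw [Finset.mem_Icc] at hp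
    exact mul_mem_span₂ hp.1 (by omega) (by omega)
  · intro y z hy hz hyz
    have h (p : ℕ) (hp : p ∈ Finset.Icc 2 (k - 2)) :
        coef₂ y z ((-1 : K) ^ p • (e K p * e K (k - p))) =
          (if y = p then (-1) ^ p else 0) - (if z = p then (-1) ^ p else 0) := by
      rw [Finset.mem_Icc] at hp
      rw [map_smul, coef₂_e_mul_e (by omega) (by omega) (by omega) (by omega), ← ite_and, ← ite_and,
        smul_eq_mul, mul_sub, mul_ite, mul_ite, mul_one, mul_zero]
      congr 2 <;> (rw [eq_iff_iff]; omega)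
    have hy' : y ∈ Finset.Icc 2 (k - 2) := by rw [Finset.mem_Icc]; omega
    have hz' : z ∈ Finset.Icc 2 (k - 2) := by rw [Finset.mem_Icc]; omega
    rw [map_smul, map_sum, Finset.sum_congr rfl h, Finset.sum_sub_distrib, Finset.sum_ite_eq,
      Finset.sum_ite_eq, if_pos hy', if_pos hz', smul_eq_mul]
    rw [← hyz, Nat.odd_add] at hk
    rcases Nat.even_or_odd z with h | h
    · rw [h.neg_one_pow, (hk.mpr h).neg_one_pow]; norm_num
    · rw [h.neg_one_pow, (Nat.not_odd_iff_even.mp fun h' => Nat.not_even_iff_odd.mpr h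
        (hk.mp h')).neg_one_pow]
      norm_num

end Coboundaries

section Cohomology

open ExteriorAlgebra

variable {d D : Module.End K (ExteriorAlgebra K (ℕ →₀ K))}

lemma exists_coef₃_two_eq (hd : IsCEDifferential d) (hD : IsShiftDerivation D) {k : ℕ} (t : K)
    (hk : Odd k) : ∃ v ∈ span₂ K 2 0 k, d v ∈ span₃ K 2 0 k ∧ ∀ y z, 3 ≤ y → 3 ≤ z →
      y + z + 2 = k → coef₃ 2 y z (d v) = t * (-1) ^ y := by
  obtain ⟨v, hv, hcoef⟩ := exists_coef₂_eq_neg_one_pow (K := K) hk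
  obtain ⟨v', hv', hdv, hcoef'⟩ := exists_differential_eq₂ hd hD hv
  have hDv : e K 1 * D v = 0 := by
    refine eq_zero_of_coef₃ (s := 0) (k := k) le_rfl (e_mul_mem_span₃ (s := 1) le_rfl rfl
      (span₂_mono (by norm_num) (hD.mem_span₂ hv))) fun x y z hx hxy hyz => ?_
    rw [coef₃_e_mul (by omega) (by omega) (by omega) le_rfl, if_neg (c := y = 1) (by omega),
      if_neg (c := z = 1) (by omega), sub_zero, add_zero, ite_eq_right_iff]
    intro _
    by_cases h : y + z + 1 = k
    · rw [hD.coef₂ (by omega) (by omega) hv, hcoef _ _ (by omega) (by omega) (by omega),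
        hcoef _ _ (by omega) (by omega) (by omega), pow_succ]
      ring
    · exact coef₂_eq_zero (by norm_num) (by omega) (by omega) (hD.mem_span₂ hv) (by omega)
  rw [hDv, zero_add] at hdv
  refine ⟨(t / 2) • v, Submodule.smul_mem _ _ hv, ?_, fun y z hy hz h => ?_⟩
  · rw [map_smul, hdv]
    exact Submodule.smul_mem _ _ (e_mul_mem_span₃ le_rfl rfl hv')
  · rw [map_smul, hdv, map_smul, coef₃_e_mul (by omega) (by omega) (by omega) (by omega),
      if_pos rfl, if_neg (by omega), if_neg (by omega), sub_zero, add_zero, hcoef' y z hy hz,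
      hcoef _ _ (by omega) (by omega) (by omega), hcoef _ _ (by omega) (by omega) (by omega),
      smul_eq_mul, pow_add]
    ring

lemma eq_zero_of_coef₃_two {k : ℕ} {u : ExteriorAlgebra K (ℕ →₀ K)} (hu : u ∈ span₃ K 2 0 k)
    (h₃ : ∀ x y z, 3 ≤ x → 3 ≤ y → 3 ≤ z → coef₃ x y z u = 0)
    (h₂ : ∀ y z, 3 ≤ y → 3 ≤ z → y + z + 2 = k → coef₃ 2 y z u = 0) : u = 0 := by
  refine eq_zero_of_coef₃ (by norm_num) hu fun x y z hx hxy hyz => ?_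
  by_cases hxk : x < 2 ∨ x + y + z + 0 ≠ k
  · exact coef₃_eq_zero (by norm_num) hx (by omega) (by omega) hu (by omega)
  obtain rfl | hx : x = 2 ∨ 3 ≤ x := by omega
  · exact h₂ y z (by omega) (by omega) (by omega)
  · exact h₃ x y z hx (by omega) (by omega)

/-- A cocycle in the `e^a` with `a ≥ 2` is a coboundary if its coefficient at the middle triple
`(j, j + 1, j + 2)` vanishes. -/
lemma exists_differential_eq_of_mem_two (hd : IsCEDifferential d) (hD : IsShiftDerivation D)
    {k : ℕ} {u : ExteriorAlgebra K (ℕ →₀ K)} (hu : u ∈ span₃ K 2 0 k) (hdu : d u = 0)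
    (h₀ : ∀ j, 3 ≤ j → coef₃ j (j + 1) (j + 2) u = 0) : ∃ v ∈ span₂ K 2 0 k, d v = u := by
  obtain ⟨u', hu', hdu', hcoef⟩ := exists_differential_eq₃ hd hD hu
  obtain ⟨hDu, hu'0⟩ := coef₃_eq_zero_of_add_eq_zero hu' (hdu'.symm.trans hdu)
  have hshift (x y z : ℕ) (hx : 2 ≤ x) (hy : 2 ≤ y) (hz : 2 ≤ z) :
      coef₃ (x + 1) y z u + coef₃ x (y + 1) z u + coef₃ x y (z + 1) u = 0 := by
    rw [← hD.coef₃ hx hy hz hu, hDu x y z hx hy hz]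
  have h₃ (x y z : ℕ) (hx : 3 ≤ x) (hy : 3 ≤ y) (hz : 3 ≤ z) : coef₃ x y z u = 0 :=
    (isAlternating₃_coef₃ u).eq_zero_of_power_sums
      (fun x y z hx hy hz => hshift x y z (by omega) (by omega) (by omega))
      (fun x y z hx hy hz => by rw [← hcoef x y z hx hy hz, hu'0 x y z hx hy hz]) h₀ hx hy hz
  have hmove (i z : ℕ) (hz : 3 ≤ z) :
      coef₃ 2 (3 + i) z u = (-1) ^ i * coef₃ 2 3 (z + i) u := by
    induction i generalizing z with
    | zero => simp
    | succ i ih =>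
      have h := hshift 2 (3 + i) z le_rfl (by omega) (by omega)
      rw [h₃ _ _ _ (by omega) (by omega) hz, zero_add, ih (z + 1) (by omega), add_assoc 3,
        add_right_comm z] at h
      rw [← add_assoc z, pow_succ]
      linear_combination h
  set t := coef₃ 2 3 (k - 5) u
  have hval (y z : ℕ) (hy : 3 ≤ y) (hz : 3 ≤ z) (h : y + z + 2 = k) :
      coef₃ 2 y z u = -t * (-1) ^ y := by
    obtain ⟨i, rfl⟩ := Nat.exists_eq_add_of_le hy
    rw [hmove i z hz, show z + i = k - 5 by omega, pow_add]
    simp only [t]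
    ring
  rcases Nat.even_or_odd k with hk | hk
  · refine ⟨0, zero_mem _, (map_zero d).trans (eq_zero_of_coef₃_two hu h₃ ?_).symm⟩
    intro y z hy hz h
    have h₁ := hval y z hy hz h
    have h₂ := hval z y hz hy (by omega)
    have h₄ : (-1 : K) ^ z = (-1) ^ y := by
      have hyz : Even (y + z) := by rw [Nat.even_iff] at hk ⊢; omega
      rw [Nat.even_add] at hyz
      rcases Nat.even_or_odd y with hy | hy
      · rw [hy.neg_one_pow, (hyz.mp hy).neg_one_pow]
      · rw [hy.neg_one_pow, (Nat.not_even_iff_odd.mp fun hz =>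
          Nat.not_even_iff_odd.mpr hy (hyz.mpr hz)).neg_one_pow]
    rw [coef₃_swap_right, h₄] at h₂
    linear_combination h₁ / 2 - h₂ / 2
  · obtain ⟨v, hv, hdv, hcv⟩ := exists_coef₃_two_eq hd hD (-t) hk
    refine ⟨v, hv, sub_eq_zero.mp (eq_zero_of_coef₃_two (sub_mem hdv hu) ?_ ?_)⟩
    · intro x y z hx hy hz
      rw [map_sub, h₃ x y z hx hy hz,
        hd.coef₃_map hx hy hz (span₂_mono (by norm_num) hv), sub_zero]
    · intro y z hy hz h
      rw [map_sub, hcv y z hy hz h, hval y z hy hz h, sub_self]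

lemma exists_differential_eq (hd : IsCEDifferential d) (hD : IsShiftDerivation D)
    {k : ℕ} {z : ExteriorAlgebra K (ℕ →₀ K)} (hz : z ∈ span₃ K 1 0 k) (hdz : d z = 0)
    (h₀ : ∀ j, 3 ≤ j → coef₃ j (j + 1) (j + 2) z = 0) : ∃ v ∈ span₂ K 1 0 k, d v = z := by
  obtain ⟨u, hu, v, hv, rfl⟩ := exists_eq_add_e_one_mul hz
  obtain ⟨x, hx, rfl⟩ := hD.exists_map_eq hv
  obtain ⟨x', hx', hdx, -⟩ := exists_differential_eq₂ hd hD hx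
  have hx₁ := span₂_mono (by norm_num : 1 ≤ 2) hx
  have hsub : u + e K 1 * D x - d x = u - e K 2 * x' := by rw [hdx]; abel
  obtain ⟨y, hy, hdy⟩ := exists_differential_eq_of_mem_two hd hD
    (sub_mem hu (e_mul_mem_span₃ le_rfl (by norm_num) hx')) (by
      rw [← hsub, map_sub, hdz, hd.map_map hx₁, sub_zero]) (fun j hj => by
      rw [← hsub, map_sub, h₀ j hj, hd.coef₃_map hj (by omega) (by omega) hx₁, sub_zero])
  exact ⟨x + y, add_mem hx₁ (span₂_mono (by norm_num) hy), by rw [map_add, hdy, ← hsub]; abel⟩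

instance (k : ℕ) : FiniteDimensional K (span₂ K 1 0 k) := by
  refine FiniteDimensional.span_of_finite K (((Finset.range (k + 1)).finite_toSet.image2
    (fun a b => e K a * e K b) (Finset.range (k + 1)).finite_toSet).subset ?_)
  rintro x ⟨a, b, -, -, hk, rfl⟩
  exact ⟨a, by simp; omega, b, by simp; omega, rfl⟩

lemma finrank_sub_finrank_eq_one {V : Type*} [AddCommGroup V] [Module K V] {B Z : Submodule K V}
    [FiniteDimensional K B] {w : V} (hBZ : B ≤ Z) (hw : w ∈ Z) (hwB : w ∉ B)
    (h : ∀ z ∈ Z, ∃ t : K, z - t • w ∈ B) :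
    Module.finrank K Z - Module.finrank K B = 1 := by
  have hZ : Z = B ⊔ Submodule.span K {w} := by
    refine le_antisymm (fun z hz => ?_)
      (sup_le hBZ ((Submodule.span_singleton_le_iff_mem _ _).mpr hw))
    obtain ⟨t, ht⟩ := h z hz
    exact Submodule.mem_sup.mpr ⟨_, ht, t • w, Submodule.mem_span_singleton.mpr ⟨t, rfl⟩,
      sub_add_cancel _ _⟩
  have hinf : B ⊓ Submodule.span K {w} = ⊥ := by
    rw [← disjoint_iff, Submodule.disjoint_span_singleton' (by rintro rfl; exact hwB (zero_mem _))]
    exact hwB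
  have hw0 : w ≠ 0 := by rintro rfl; exact hwB (zero_mem _)
  have := Submodule.finrank_sup_add_finrank_inf_eq B (Submodule.span K {w})
  rw [hinf, finrank_bot, ← hZ, finrank_span_singleton hw0] at this
  omega

lemma basicCocycle_notMem_map (hd : IsCEDifferential d) (hD : IsShiftDerivation D) {j : ℕ}
    (hj : 3 ≤ j) : basicCocycle D j ∉ (span₂ K 1 0 (3 * j + 3)).map d := by
  rintro ⟨v, hv, h⟩
  have := hd.coef₃_map (x := j) (y := j + 1) (z := j + 1 + 1) hj (by omega) (by omega) hv
  rw [h, coef₃_basicCocycle hD (by omega) (by omega) (by omega) (by omega), signCoef_succ,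
    if_pos (by omega)] at this
  exact one_ne_zero this

lemma finrank_cohomology (hd : IsCEDifferential d) (hD : IsShiftDerivation D) (k : ℕ) :
    Module.finrank K ↥(span₃ K 1 0 k ⊓ LinearMap.ker d) -
      Module.finrank K ↥((span₂ K 1 0 k).map d) = if k % 3 = 0 ∧ 12 ≤ k then 1 else 0 := by
  have hBZ : (span₂ K 1 0 k).map d ≤ span₃ K 1 0 k ⊓ LinearMap.ker d := by
    rintro _ ⟨v, hv, rfl⟩
    exact ⟨hd.mem_span₃ hv, hd.map_map hv⟩
  split_ifs with hk
  · obtain ⟨j, rfl⟩ : ∃ j, k = 3 * j + 3 := ⟨k / 3 - 1, by omega⟩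
    have hj : 3 ≤ j := by omega
    have hw : basicCocycle D j ∈ span₃ K 1 0 (3 * j + 3) :=
      span₃_mono (by norm_num) (basicCocycle_mem hD (by omega))
    have hdw := differential_basicCocycle hd hD (j := j) (by omega)
    refine finrank_sub_finrank_eq_one hBZ (w := basicCocycle D j) ⟨hw, hdw⟩
      (basicCocycle_notMem_map hd hD hj) ?_
    rintro z ⟨hz, hdz⟩
    rw [SetLike.mem_coe, LinearMap.mem_ker] at hdz
    have hmem := sub_mem hz (Submodule.smul_mem _ (coef₃ j (j + 1) (j + 2) z) hw)
    refine ⟨coef₃ j (j + 1) (j + 2) z, exists_differential_eq hd hD hmem ?_ fun i hi => ?_⟩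
    · rw [map_sub, map_smul, hdz, hdw, smul_zero, sub_zero]
    · by_cases hij : i = j
      · rw [hij, map_sub, map_smul,
          coef₃_basicCocycle hD (by omega) (by omega) (by omega) (by omega), signCoef_succ,
          if_pos (by omega), smul_eq_mul, mul_one, sub_self]
      · exact coef₃_eq_zero le_rfl (by omega) (by omega) (by omega) hmem (by omega)
  · rw [Nat.sub_eq_zero_iff_le, le_antisymm hBZ]
    rintro z ⟨hz, hdz⟩
    exact exists_differential_eq hd hD hz hdz fun j hj =>
      coef₃_eq_zero le_rfl (by omega) (by omega) (by omega) hz (by omega)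

lemma IsCEDifferential.of_leibniz
    (hLeib : ∀ p : ℕ, ∀ x ∈ LamDeg K p, ∀ y,
      d (x * y) = d x * y + ((-1 : K) ^ p) • (x * d y))
    (h1 : d (e K 1) = 0) (h2 : d (e K 2) = 0)
    (h3 : d (e K 3) = e K 1 * e K 2)
    (h4 : d (e K 4) = e K 1 * e K 3)
    (hd : ∀ i, 4 ≤ i → d (e K (i + 1)) = e K 1 * e K i + e K 2 * e K (i - 1)) :
    IsCEDifferential d where
  one := h1
  gen a ha := by
    rw [ι_shiftVec, ι_shiftVec]
    obtain rfl | rfl | rfl | ha : a = 2 ∨ a = 3 ∨ a = 4 ∨ 5 ≤ a := by omega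
    · simp [h2]
    · simp [h3]
    · simp [h4]
    · obtain ⟨i, rfl⟩ : ∃ i, a = i + 1 := ⟨a - 1, by omega⟩
      rw [hd i (by omega), if_pos (by omega), if_pos ha]
      rfl
  mul a ha y := by
    rw [hLeib 1 (e K a) (Submodule.subset_span ⟨{a}, by simp, by simpa using ha, by simp [mono]⟩),
      pow_one, neg_one_smul, sub_eq_add_neg]

lemma IsShiftDerivation.of_leibniz (hDLeib : ∀ x y, D (x * y) = D x * y + x * D y)
    (hD2 : D (e K 2) = 0) (hDj : ∀ j, 3 ≤ j → D (e K j) = e K (j - 1)) :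
    IsShiftDerivation D where
  gen a ha := by
    rw [ι_shiftVec]
    split_ifs with h
    · exact hDj a h
    · rw [show a = 2 by omega, hD2]
  mul := hDLeib

end Cohomology

end Auxiliary

/-- `dim H^3_k(m₂) = 1` if `k = 3m` with `m ≥ 4`, and `0` otherwise; a basis is given by
the cocycles `w_{j,j+1,j+2} = Σ_{l ≥ 0} ω(e^{j-2l} ∧ e^{j+1+l} ∧ e^{j+2+l})` for `j ≥ 3`,
where `ω(e^a ∧ e^b ∧ e^{b+1}) = Σ_{m ≥ 0} (-1)^m (ad e₁^*)^m (e^a ∧ e^b) ∧ e^{b+1+m}`.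
Here `d` is the Chevalley–Eilenberg differential of `m₂` and `D = ad e₁^*` is the even
derivation with `D e^1 = D e^2 = 0`, `D e^j = e^{j-1}` for `j ≥ 3`. -/
theorem stmt18 (d D : Module.End K (ExteriorAlgebra K (ℕ →₀ K)))
    (hLeib : ∀ p : ℕ, ∀ x ∈ LamDeg K p, ∀ y,
      d (x * y) = d x * y + ((-1 : K) ^ p) • (x * d y))
    (h1 : d (e K 1) = 0) (h2 : d (e K 2) = 0)
    (h3 : d (e K 3) = e K 1 * e K 2)
    (h4 : d (e K 4) = e K 1 * e K 3)
    (hd : ∀ i, 4 ≤ i → d (e K (i + 1)) = e K 1 * e K i + e K 2 * e K (i - 1))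
    (hDLeib : ∀ x y, D (x * y) = D x * y + x * D y)
    (hD1 : D (e K 1) = 0) (hD2 : D (e K 2) = 0)
    (hDj : ∀ j, 3 ≤ j → D (e K j) = e K (j - 1)) :
    (∀ k : ℕ,
      Module.finrank K ↥(LamWt K 3 k ⊓ LinearMap.ker d) -
        Module.finrank K ↥((LamWt K 2 k).map d) =
          if k % 3 = 0 ∧ 12 ≤ k then 1 else 0) ∧
    (∀ j : ℕ, 3 ≤ j →
      let w : ExteriorAlgebra K (ℕ →₀ K) :=
        ∑ l ∈ Finset.range ((j - 2) / 2 + 1), ∑ m ∈ Finset.range (2 * j + 2),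
          ((-1 : K) ^ m) • ((D ^ m) (e K (j - 2 * l) * e K (j + 1 + l)) *
            e K (j + 2 + l + m));
      w ∈ LamWt K 3 (3 * j + 3) ∧ d w = 0 ∧ w ∉ (LamWt K 2 (3 * j + 3)).map d) := by
  have hd' := IsCEDifferential.of_leibniz hLeib h1 h2 h3 h4 hd
  have hD' := IsShiftDerivation.of_leibniz hDLeib hD2 hDj
  refine ⟨fun k => ?_, fun j hj => ?_⟩
  · rw [LamWt_two, LamWt_three]
    exact finrank_cohomology hd' hD' k
  have hw : (∑ l ∈ Finset.range ((j - 2) / 2 + 1), ∑ m ∈ Finset.range (2 * j + 2),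
      ((-1 : K) ^ m) • ((D ^ m) (e K (j - 2 * l) * e K (j + 1 + l)) * e K (j + 2 + l + m))) =
      basicCocycle D j := by
    refine Finset.sum_congr rfl fun l _ => Finset.sum_congr rfl fun m _ => ?_
    rw [show j + 2 + l = j + 1 + l + 1 by omega]
  rw [LamWt_two, LamWt_three, hw]
  exact ⟨span₃_mono (by norm_num) (basicCocycle_mem hD' (by omega)),
    differential_basicCocycle hd' hD' (by omega), basicCocycle_notMem_map hd' hD' hj⟩
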